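/- Let δ ∈ {1, 2} and suppose n = δ·p₁⋯p_{t₁}·q₁⋯q_{t₂}, where p₁,…,p_{t₁},q₁,…,q_{t₂} are distinct primes, all congruent to 3 (mod 4) and coprime to l, with (p_i/l) = −1 for all i ∈ {1,…,t₁}, (q_j/l) = 1 for all j ∈ {1,…,t₂}, and t₁ + t₂ odd. Then r₂(H) = t₁ + 2t₂. -/

import Mathlib

/-- `ε` is the fundamental unit of the real quadratic field `ℚ(√l)` (viewed inside `ℝ`):
it lies in `ℚ(√l)`, it is a unit of the ring of integers (both `ε` and `ε⁻¹` are
algebraic integers), `ε > 1`, and it is the smallest such unit. -/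
def IsFundamentalUnit (l : ℕ) (ε : ℝ) : Prop :=
  1 < ε ∧ ε ∈ IntermediateField.adjoin ℚ ({Real.sqrt (l : ℝ)} : Set ℝ) ∧
    IsIntegral ℤ ε ∧ IsIntegral ℤ ε⁻¹ ∧
    ∀ x : ℝ, 1 < x → x ∈ IntermediateField.adjoin ℚ ({Real.sqrt (l : ℝ)} : Set ℝ) →
      IsIntegral ℤ x → IsIntegral ℤ x⁻¹ → ε ≤ x

/-- The Legendre symbol `(a/p)`, via Euler's criterion (so that no `Fact p.Prime`
instance is needed): for an odd prime `p` it is `1` if `a` is a nonzero square mod `p`,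
`0` if `p ∣ a`, and `-1` otherwise. -/
def legSym (p : ℕ) (a : ℤ) : ℤ :=
  if (a : ZMod p) ^ ((p - 1) / 2) = 1 then 1 else if (a : ZMod p) = 0 then 0 else -1

/-- The rational fourth power residue symbol `(a/p)₄ ∈ {±1}`, meaningful when
`(a/p) = 1`; it is determined by `(a/p)₄ ≡ a ^ ((p-1)/4) (mod p)`. -/
def quartSym (p : ℕ) (a : ℤ) : ℤ :=
  if (a : ZMod p) ^ ((p - 1) / 4) = 1 then 1 else -1

/-- The cardinality of the 2-torsion subgroup of the class group of `K`.
For a number field `K` this equals `2 ^ r₂(H)`, where `r₂(H)` is the rank of the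
2-class group `H` of `K` (i.e. `dim_{𝔽₂} Cl(K)/Cl(K)²`); in particular
`r₂(H) = r` iff this cardinality is `2 ^ r`. -/
noncomputable def twoTorsCard (K : IntermediateField ℚ ℝ) : ℕ :=
  Nat.card {x : ClassGroup (NumberField.RingOfIntegers K) // x ^ 2 = 1}

set_option linter.unusedSectionVars false

open scoped nonZeroDivisors
open NumberField

/-- `σ` is the nontrivial automorphism of a quadratic extension `S` of `R`. -/
structure IsQuadConj (R : Type*) {S : Type*} [CommRing R] [CommRing S] [Algebra R S]
    (σ : S ≃+* S) : Prop where
  inj : Function.Injective (algebraMap R S)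
  invol : ∀ x, σ (σ x) = x
  fix_iff : ∀ x, σ x = x ↔ ∃ r, algebraMap R S r = x
  nontriv : ∃ x : S, x ≠ 0 ∧ σ x = -x

/-- The image of an ideal under a ring automorphism. -/
def Ideal.conj {S : Type*} [CommRing S] (σ : S ≃+* S) (I : Ideal S) : Ideal S :=
  I.map (σ : S →+* S)

namespace IsQuadConj

section CommRing

variable {R S : Type*} [CommRing R] [CommRing S] [Algebra R S] {σ : S ≃+* S}

theorem conj_mul (I J : Ideal S) : (I * J).conj σ = I.conj σ * J.conj σ :=
  Ideal.map_mul _ _ _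

theorem conj_pow (I : Ideal S) (n : ℕ) : (I ^ n).conj σ = I.conj σ ^ n :=
  Ideal.map_pow _ _ _

theorem conj_span_singleton (x : S) : (Ideal.span {x}).conj σ = Ideal.span {σ x} := by
  simp [Ideal.conj, Ideal.map_span]

theorem conj_mono {I J : Ideal S} (h : I ≤ J) : I.conj σ ≤ J.conj σ := Ideal.map_mono h

variable (h : IsQuadConj R σ)
include h

theorem map_algebraMap (r : R) : σ (algebraMap R S r) = algebraMap R S r :=
  (h.fix_iff _).2 ⟨r, rfl⟩

theorem mem_conj {I : Ideal S} {x : S} : x ∈ I.conj σ ↔ σ x ∈ I := by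
  rw [Ideal.conj, Ideal.map_comap_of_equiv, Ideal.mem_comap]
  suffices σ.symm x = σ x by simp [this]
  rw [RingEquiv.symm_apply_eq, h.invol]

theorem conj_conj (I : Ideal S) : (I.conj σ).conj σ = I := by
  ext x; rw [h.mem_conj, h.mem_conj, h.invol]

theorem conj_prime {P : Ideal S} [hP : P.IsPrime] : (P.conj σ).IsPrime := by
  unfold Ideal.conj
  exact Ideal.map_isPrime_of_equiv σ

theorem conj_map (I : Ideal R) :
    (I.map (algebraMap R S)).conj σ = I.map (algebraMap R S) := by
  rw [Ideal.conj, Ideal.map_map]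
  congr 1
  ext r
  exact h.map_algebraMap r

theorem exists_norm (x : S) : ∃ r, algebraMap R S r = x * σ x :=
  (h.fix_iff _).1 (by rw [map_mul, h.invol, mul_comm])

theorem exists_trace (x : S) : ∃ r, algebraMap R S r = x + σ x :=
  (h.fix_iff _).1 (by rw [map_add, h.invol, add_comm])

theorem isIntegral : Algebra.IsIntegral R S := by
  refine ⟨fun x => ?_⟩
  obtain ⟨a, ha⟩ := h.exists_trace x
  obtain ⟨b, hb⟩ := h.exists_norm x
  nontriviality R
  refine ⟨Polynomial.X ^ 2 - Polynomial.C a * Polynomial.X + Polynomial.C b, ?_, ?_⟩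
  · monicity!
  · simp [ha, hb]; ring

theorem conj_ne_bot {P : Ideal S} (hP : P ≠ ⊥) : P.conj σ ≠ ⊥ := by
  intro h0
  apply hP
  rw [← h.conj_conj P, h0]
  simp [Ideal.conj]

/-- Hilbert's theorem 90 for a quadratic extension, without denominators. -/
theorem hilbert90 [IsDomain S] {x y : S} (hy : y ≠ 0) (hxy : x * σ x = y * σ y) :
    ∃ b : S, b ≠ 0 ∧ x * σ b = y * b := by
  by_cases h0 : x + y = 0
  · obtain ⟨d, hd, hd'⟩ := h.nontriv
    refine ⟨d, hd, ?_⟩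
    rw [hd', eq_neg_of_add_eq_zero_left h0]; ring
  · refine ⟨(x + y) * σ y, mul_ne_zero h0 (by simpa using hy), ?_⟩
    simp only [map_mul, map_add, h.invol]
    linear_combination y * hxy

end CommRing

section Dedekind

variable {R S : Type*} [CommRing R] [CommRing S] [IsDedekindDomain R] [IsDedekindDomain S]
  [Algebra R S] {σ : S ≃+* S} (h : IsQuadConj R σ)
include h

theorem map_ideal_injective :
    Function.Injective (Ideal.map (algebraMap R S) : Ideal R → Ideal S) := by
  have := h.isIntegral
  have : FaithfulSMul R S := (faithfulSMul_iff_algebraMap_injective R S).2 h.inj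
  have : Module.IsTorsionFree R S := inferInstance
  have : Module.FaithfullyFlat R S := inferInstance
  exact Ideal.map_injective_of_faithfullyFlat

theorem comap_ne_bot {P : Ideal S} (hP : P ≠ ⊥) : P.comap (algebraMap R S) ≠ ⊥ := by
  obtain ⟨x, hx, hx0⟩ := Submodule.exists_mem_ne_zero_of_ne_bot hP
  obtain ⟨r, hr⟩ := h.exists_norm x
  intro hb
  have hr' : r ∈ P.comap (algebraMap R S) := by
    rw [Ideal.mem_comap, hr]; exact P.mul_mem_right _ hx
  rw [hb, Ideal.mem_bot] at hr'
  rw [hr', map_zero, eq_comm, mul_eq_zero] at hr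
  rcases hr with hr | hr
  · exact hx0 hr
  · exact hx0 (by simpa using hr)

theorem map_ne_bot {I : Ideal R} (hI : I ≠ ⊥) : I.map (algebraMap R S) ≠ ⊥ := by
  rwa [Ne, Ideal.map_eq_bot_iff_of_injective h.inj]

theorem eq_or_eq_conj {P Q : Ideal S} [hP : P.IsPrime] [hQ : Q.IsPrime] (hP0 : P ≠ ⊥)
    (hPQ : P.comap (algebraMap R S) ≤ Q.comap (algebraMap R S)) : Q = P ∨ Q = P.conj σ := by
  have hmax := hP.isMaximal hP0
  have hsub : (P : Set S) ⊆ Q ∪ Q.conj σ := by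
    intro x hx
    obtain ⟨r, hr⟩ := h.exists_norm x
    have h1 : r ∈ P.comap (algebraMap R S) := by
      rw [Ideal.mem_comap, hr]; exact P.mul_mem_right _ hx
    have h2 := hPQ h1
    rw [Ideal.mem_comap, hr] at h2
    rcases hQ.mem_or_mem h2 with h3 | h3
    · exact Or.inl h3
    · exact Or.inr (h.mem_conj.2 h3)
  rcases Ideal.subset_union.1 hsub with h1 | h1
  · exact Or.inl (hmax.eq_of_le hQ.ne_top h1).symm
  · right
    rw [hmax.eq_of_le h.conj_prime.ne_top h1, h.conj_conj]

theorem exists_le_of_ne_top {P Y : Ideal S} [hP : P.IsPrime] (hP0 : P ≠ ⊥) (hY : Y ≠ ⊤)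
    (hle : (P.comap (algebraMap R S)).map (algebraMap R S) ≤ Y) : Y ≤ P ∨ Y ≤ P.conj σ := by
  obtain ⟨Q, hQ, hYQ⟩ := Ideal.exists_le_maximal Y hY
  have := hQ.isPrime
  rcases h.eq_or_eq_conj (Q := Q) hP0 (Ideal.map_le_iff_le_comap.1 (hle.trans hYQ)) with rfl | rfl
  · exact Or.inl hYQ
  · exact Or.inr hYQ

omit h in
theorem exists_mul_eq_of_mem {P : Ideal S} {x : S} (hx : x ∈ P)
    (hx2 : x ∉ P ^ 2) : ∃ X : Ideal S, Ideal.span {x} = P * X ∧ ¬ X ≤ P := by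
  obtain ⟨X, hX⟩ := Ideal.dvd_iff_le.2 ((Ideal.span_singleton_le_iff_mem P).2 hx)
  refine ⟨X, hX, fun hXP => hx2 ?_⟩
  rw [← Ideal.span_singleton_le_iff_mem, hX, pow_two]
  exact Ideal.mul_mono_right hXP

omit h in
theorem mul_le_mul_left_iff {P I J : Ideal S} (hP : P ≠ ⊥) : P * I ≤ P * J ↔ I ≤ J := by
  rw [← Ideal.dvd_iff_le, ← Ideal.dvd_iff_le]
  exact mul_dvd_mul_iff_left hP

theorem norm_mem_map {P : Ideal S} {x : S} (hx : x ∈ P) :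
    x * σ x ∈ (P.comap (algebraMap R S)).map (algebraMap R S) := by
  obtain ⟨r, hr⟩ := h.exists_norm x
  rw [← hr]
  apply Ideal.mem_map_of_mem
  rw [Ideal.mem_comap, hr]
  exact P.mul_mem_right _ hx

omit h in
theorem not_le_sq {P : Ideal S} [hP : P.IsPrime] (hP0 : P ≠ ⊥) : ¬ P ≤ P ^ 2 := by
  intro hle
  rw [pow_two] at hle
  nth_rw 1 [← mul_one P] at hle
  rw [mul_le_mul_left_iff hP0, Ideal.one_eq_top, top_le_iff] at hle
  exact hP.ne_top hle

/-- The decomposition of the prime below `P`: inert, ramified or split. -/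
theorem decomposition {P : Ideal S} [hP : P.IsPrime] (hP0 : P ≠ ⊥) :
    (P.comap (algebraMap R S)).map (algebraMap R S) = P ∨
    ((P.comap (algebraMap R S)).map (algebraMap R S) = P ^ 2 ∧ P.conj σ = P) ∨
    ((P.comap (algebraMap R S)).map (algebraMap R S) = P * P.conj σ ∧ P.conj σ ≠ P) := by
  have hmax := hP.isMaximal hP0
  have hMP : (P.comap (algebraMap R S)).map (algebraMap R S) ≤ P := Ideal.map_comap_le
  have hconjM := h.conj_map (P.comap (algebraMap R S))
  have hnorm : ∀ x ∈ P, x * σ x ∈ (P.comap (algebraMap R S)).map (algebraMap R S) :=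
    fun x hx => h.norm_mem_map hx
  have hle' : ∀ Y : Ideal S, Y ≠ ⊤ →
      (P.comap (algebraMap R S)).map (algebraMap R S) ≤ Y → Y ≤ P ∨ Y ≤ P.conj σ :=
    fun Y hY hle => h.exists_le_of_ne_top hP0 hY hle
  generalize (P.comap (algebraMap R S)).map (algebraMap R S) = M at *
  obtain ⟨X, hX⟩ := Ideal.dvd_iff_le.2 hMP
  by_cases hc : P.conj σ = P
  · by_cases hXt : X = ⊤
    · left; rw [hX, hXt, Ideal.mul_top]
    have hXP : X ≤ P := by
      have := hle' X hXt (hX ▸ Ideal.mul_le_right)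
      rwa [hc, or_self] at this
    obtain ⟨Y, hY⟩ := Ideal.dvd_iff_le.2 hXP
    by_cases hYt : Y = ⊤
    · right; left; rw [hX, hY, hYt, Ideal.mul_top, pow_two]; exact ⟨rfl, hc⟩
    exfalso
    have hYP : Y ≤ P := by
      have := hle' Y hYt (by rw [hX, hY]; exact Ideal.mul_le_right.trans Ideal.mul_le_right)
      rwa [hc, or_self] at this
    obtain ⟨x, hx, hx2⟩ := SetLike.not_le_iff_exists.1 (not_le_sq hP0)
    obtain ⟨Z, hZ, hZP⟩ := exists_mul_eq_of_mem hx hx2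
    have h1 : Ideal.span {x * σ x} ≤ M := (Ideal.span_singleton_le_iff_mem _).2 (hnorm x hx)
    rw [← Ideal.span_singleton_mul_span_singleton, ← conj_span_singleton, hZ, conj_mul, hc, hX, hY,
      mul_mul_mul_comm, mul_assoc, mul_le_mul_left_iff hP0, mul_le_mul_left_iff hP0] at h1
    rcases hP.mul_le.1 (h1.trans hYP) with h2 | h2
    · exact hZP h2
    · have h3 := conj_mono (σ := σ) h2
      rw [h.conj_conj, hc] at h3
      exact hZP h3
  · right; right
    refine ⟨?_, hc⟩
    have hPc : ¬ P ≤ P.conj σ := fun hle =>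
      hc (hmax.eq_of_le h.conj_prime.ne_top hle).symm
    have hMc : M ≤ P.conj σ := hconjM ▸ conj_mono hMP
    have hPcp := h.conj_prime (P := P)
    have hXP : X ≤ P.conj σ := by
      rw [hX] at hMc
      exact (hPcp.mul_le.1 hMc).resolve_left hPc
    obtain ⟨Y, hY⟩ := Ideal.dvd_iff_le.2 hXP
    suffices hYt : Y = ⊤ by rw [hX, hY, hYt, Ideal.mul_top]
    by_contra hYt
    have key : M ≤ P * P := by
      rcases hle' Y hYt (by rw [hX, hY]; exact Ideal.mul_le_right.trans Ideal.mul_le_right)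
        with hYP | hYP
      · rw [hX]
        exact Ideal.mul_mono_right (hY ▸ Ideal.mul_le_right.trans hYP)
      · rw [← hconjM, hX, conj_mul, mul_comm, hY, conj_mul, h.conj_conj]
        have := conj_mono (σ := σ) hYP
        rw [h.conj_conj] at this
        exact Ideal.mul_le_left.trans (Ideal.mul_mono_right this)
    have hns : ¬ (P : Set S) ⊆ (P ^ 2 : Ideal S) ∪ (P.conj σ) := by
      rw [Ideal.subset_union]
      rintro (h1 | h1)
      · exact not_le_sq hP0 h1
      · exact hPc h1
    obtain ⟨x, hx, hx2⟩ := Set.not_subset.1 hns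
    rw [Set.mem_union, not_or] at hx2
    obtain ⟨Z, hZ, hZP⟩ := exists_mul_eq_of_mem hx hx2.1
    have h1 := (Ideal.span_singleton_le_iff_mem _).2 (key (hnorm x hx))
    rw [← Ideal.span_singleton_mul_span_singleton, hZ, mul_assoc, mul_le_mul_left_iff hP0] at h1
    rcases hP.mul_le.1 h1 with h2 | h2
    · exact hZP h2
    · exact hx2.2 (h.mem_conj.2 ((Ideal.span_singleton_le_iff_mem _).1 h2))

/-- `P` is ramified over `R`. -/
theorem conj_eq_of_ramified {P : Ideal S} [hP : P.IsPrime] (hP0 : P ≠ ⊥)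
    (hr : (P.comap (algebraMap R S)).map (algebraMap R S) = P ^ 2) : P.conj σ = P := by
  rcases h.decomposition hP0 with h1 | h1 | h1
  · exact absurd (h1 ▸ hr).le (not_le_sq hP0)
  · exact h1.2
  · have h2 := h1.1
    rw [hr, pow_two] at h2
    exact (mul_left_cancel₀ hP0 h2).symm

theorem sub_mem_of_ramified {P : Ideal S} [hP : P.IsPrime] (hP0 : P ≠ ⊥)
    (hr : (P.comap (algebraMap R S)).map (algebraMap R S) = P ^ 2) (x : S) : x - σ x ∈ P := by
  have hc := h.conj_eq_of_ramified hP0 hr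
  obtain ⟨y, hy, hy2⟩ := SetLike.not_le_iff_exists.1 (not_le_sq hP0)
  have htr : ∀ z ∈ P, z + σ z ∈ P ^ 2 := by
    intro z hz
    obtain ⟨r, hrz⟩ := h.exists_trace z
    rw [← hrz, ← hr]
    apply Ideal.mem_map_of_mem
    rw [Ideal.mem_comap, hrz]
    exact P.add_mem hz (by rw [← h.mem_conj, hc]; exact hz)
  have h1 := htr y hy
  have h2 := htr (x * y) (P.mul_mem_left x hy)
  have h3 : (x - σ x) * y ∈ P ^ 2 := by
    have := sub_mem h2 (Ideal.mul_mem_left _ (σ x) h1)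
    rw [map_mul] at this
    convert this using 1; ring
  obtain ⟨Z, hZ, hZP⟩ := exists_mul_eq_of_mem hy hy2
  rw [← Ideal.span_singleton_le_iff_mem, mul_comm, ← Ideal.span_singleton_mul_span_singleton, hZ,
    pow_two, mul_assoc, mul_le_mul_left_iff hP0] at h3
  rcases hP.mul_le.1 h3 with h4 | h4
  · exact absurd h4 hZP
  · exact (Ideal.span_singleton_le_iff_mem _).1 h4

/-- An Eisenstein element at the prime below `P` forces ramification. -/
theorem ramified_of_eisenstein {P : Ideal S} [hP : P.IsPrime] (hP0 : P ≠ ⊥) {θ : S} {a b : R}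
    (hθ : θ ^ 2 = algebraMap R S a * θ + algebraMap R S b)
    (ha : a ∈ P.comap (algebraMap R S)) (hb : b ∈ P.comap (algebraMap R S))
    (hb2 : b ∉ P.comap (algebraMap R S) ^ 2) :
    (P.comap (algebraMap R S)).map (algebraMap R S) = P ^ 2 := by
  have hmem : ∀ Q : Ideal S, Q.IsPrime →
      (P.comap (algebraMap R S)).map (algebraMap R S) ≤ Q → θ ∈ Q := by
    intro Q hQ hle
    have ha' := hle (Ideal.mem_map_of_mem _ ha)
    have hb' := hle (Ideal.mem_map_of_mem _ hb)
    refine hQ.mem_of_pow_mem 2 ?_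
    rw [hθ]
    exact Q.add_mem (Q.mul_mem_right _ ha') hb'
  have hθP := hmem P hP Ideal.map_comap_le
  by_contra hne
  have hθM : θ ∈ (P.comap (algebraMap R S)).map (algebraMap R S) := by
    rcases h.decomposition hP0 with h1 | h1 | h1
    · rwa [h1]
    · exact absurd h1.1 hne
    · have hcp := h.conj_prime (P := P)
      have h2 := hmem _ hcp (h1.1 ▸ Ideal.mul_le_right)
      obtain ⟨X, hX⟩ := Ideal.dvd_iff_le.2 ((Ideal.span_singleton_le_iff_mem P).2 hθP)
      rw [h1.1, ← Ideal.span_singleton_le_iff_mem, hX]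
      refine Ideal.mul_mono_right ?_
      rw [← Ideal.span_singleton_le_iff_mem, hX] at h2
      refine (hcp.mul_le.1 h2).resolve_left fun hle => h1.2 ?_
      exact ((hP.isMaximal hP0).eq_of_le hcp.ne_top hle).symm
  apply hb2
  have hbm : algebraMap R S b ∈ ((P.comap (algebraMap R S)) ^ 2).map (algebraMap R S) := by
    rw [Ideal.map_pow, pow_two]
    have : algebraMap R S b = θ * θ - algebraMap R S a * θ := by
      linear_combination -hθ
    rw [this]
    exact sub_mem (Ideal.mul_mem_mul hθM hθM)
      (Ideal.mul_mem_mul (Ideal.mem_map_of_mem _ ha) hθM)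
  have hsup : ((P.comap (algebraMap R S)) ^ 2 ⊔ Ideal.span {b}).map (algebraMap R S) =
      ((P.comap (algebraMap R S)) ^ 2).map (algebraMap R S) := by
    rw [Ideal.map_sup, Ideal.map_span, Set.image_singleton, sup_eq_left,
      Ideal.span_singleton_le_iff_mem]
    exact hbm
  have := h.map_ideal_injective hsup
  rwa [sup_eq_left, Ideal.span_singleton_le_iff_mem] at this

end Dedekind

end IsQuadConj

/-- The prime ideals of `S` ramified over `R` in a quadratic extension. -/
def ramifiedPrimes (R S : Type*) [CommRing R] [CommRing S] [Algebra R S] : Set (Ideal S) :=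
  {P | P.IsPrime ∧ P ≠ ⊥ ∧ (P.comap (algebraMap R S)).map (algebraMap R S) = P ^ 2}

namespace IsQuadConj

variable {R S : Type*} [CommRing R] [CommRing S] [IsDedekindDomain R] [IsDedekindDomain S]
  [Algebra R S] {σ : S ≃+* S} (h : IsQuadConj R σ)
include h

theorem exists_norm_ideal (I : Ideal S) : ∃ N : Ideal R, N.map (algebraMap R S) = I * I.conj σ := by
  induction I using UniqueFactorizationMonoid.induction_on_prime with
  | h₁ => exact ⟨⊥, by simp⟩
  | h₂ I hI =>
    rw [Ideal.isUnit_iff] at hI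
    exact ⟨⊤, by rw [hI, Ideal.map_top, Ideal.top_mul, Ideal.conj, Ideal.map_top]⟩
  | h₃ I P hI hP ih =>
    obtain ⟨N, hN⟩ := ih
    have hPp := Ideal.isPrime_of_prime hP
    have hP0 : P ≠ ⊥ := hP.ne_zero
    suffices ∃ M : Ideal R, M.map (algebraMap R S) = P * P.conj σ by
      obtain ⟨M, hM⟩ := this
      exact ⟨M * N, by rw [Ideal.map_mul, hM, hN, conj_mul, mul_mul_mul_comm]⟩
    rcases h.decomposition hP0 with h1 | h1 | h1
    · refine ⟨P.comap (algebraMap R S) ^ 2, ?_⟩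
      have h2 := h.conj_map (P.comap (algebraMap R S))
      rw [h1] at h2
      rw [Ideal.map_pow, h1, h2, pow_two]
    · exact ⟨P.comap (algebraMap R S), by rw [h1.1, h1.2, pow_two]⟩
    · exact ⟨_, h1.1⟩

theorem conj_eq_of_mul_map {I : Ideal S} {J : Ideal S} (hJ : J ≠ ⊥) (hJc : J.conj σ = J)
    (hI : (J * I).conj σ = J * I) : I.conj σ = I := by
  rw [conj_mul, hJc] at hI
  exact mul_left_cancel₀ hJ hI

/-- An ideal fixed by conjugation is a product of ramified primes times an ideal from below. -/
theorem exists_eq_prod_mul_map (I : Ideal S) (hI0 : I ≠ ⊥) (hI : I.conj σ = I) :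
    ∃ (s : Finset (Ideal S)) (b : Ideal R), ↑s ⊆ ramifiedPrimes R S ∧
      I = (∏ P ∈ s, P) * b.map (algebraMap R S) := by
  classical
  induction I using WellFoundedGT.induction with
  | ind I ih =>
    by_cases hIt : I = ⊤
    · exact ⟨∅, ⊤, by simp, by rw [hIt, Ideal.map_top, Finset.prod_empty, Ideal.mul_top,
        Ideal.one_eq_top]⟩
    obtain ⟨P, hPm, hIP⟩ := Ideal.exists_le_maximal I hIt
    have hP := hPm.isPrime
    have hP0 : P ≠ ⊥ := fun h0 => hI0 (le_bot_iff.1 (h0 ▸ hIP))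
    have hJ0 := h.map_ne_bot (h.comap_ne_bot hP0)
    have hJc := h.conj_map (P.comap (algebraMap R S))
    have lt_of : ∀ J X : Ideal S, J ≤ P → I = J * X → I < X := by
      intro J X hJP hX
      have hX0 : X ≠ ⊥ := by rintro rfl; exact hI0 (by rw [hX, Ideal.mul_bot])
      refine lt_of_le_of_ne (hX ▸ Ideal.mul_le_right) fun heq => ?_
      rw [← one_mul I, heq] at hX
      have := mul_right_cancel₀ hX0 hX
      exact hP.ne_top (top_le_iff.1 (by rw [← Ideal.one_eq_top, this]; exact hJP))
    have main : ∀ X : Ideal S, I = (P.comap (algebraMap R S)).map (algebraMap R S) * X →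
        ∃ (s : Finset (Ideal S)) (b : Ideal R), ↑s ⊆ ramifiedPrimes R S ∧
          I = (∏ P ∈ s, P) * b.map (algebraMap R S) := by
      intro X hX
      have hX0 : X ≠ ⊥ := by rintro rfl; exact hI0 (by rw [hX, Ideal.mul_bot])
      obtain ⟨s, b, hs, hb⟩ := ih X (lt_of _ X Ideal.map_comap_le hX) hX0
        (h.conj_eq_of_mul_map hJ0 hJc (hX ▸ hI))
      refine ⟨s, P.comap (algebraMap R S) * b, hs, ?_⟩
      rw [Ideal.map_mul]
      nth_rw 1 [hX, hb]
      ring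
    obtain ⟨X, hX⟩ := Ideal.dvd_iff_le.2 hIP
    rcases h.decomposition hP0 with h1 | h1 | h1
    · exact main X (by rw [h1, hX])
    · have hX0 : X ≠ ⊥ := by rintro rfl; exact hI0 (by rw [hX, Ideal.mul_bot])
      obtain ⟨s, b, hs, hb⟩ := ih X (lt_of P X le_rfl hX) hX0
        (h.conj_eq_of_mul_map hP0 h1.2 (hX ▸ hI))
      by_cases hPs : P ∈ s
      · refine ⟨s.erase P, P.comap (algebraMap R S) * b,
          (Finset.coe_subset.2 (s.erase_subset P)).trans hs, ?_⟩
        rw [Ideal.map_mul, h1.1]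
        nth_rw 1 [hX, hb, ← Finset.mul_prod_erase s _ hPs]
        ring
      · refine ⟨insert P s, b, ?_, ?_⟩
        · rw [Finset.coe_insert]
          exact Set.insert_subset ⟨hP, hP0, h1.1⟩ hs
        · rw [Finset.prod_insert hPs]
          nth_rw 1 [hX, hb]
          ring
    · have hcp := h.conj_prime (P := P)
      have h2 : P * X ≤ P.conj σ := by
        have := conj_mono (σ := σ) hIP
        rwa [hI, hX] at this
      obtain ⟨Y, hY⟩ := Ideal.dvd_iff_le.2 ((hcp.mul_le.1 h2).resolve_left fun hle =>
        h1.2 (hPm.eq_of_le hcp.ne_top hle).symm)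
      exact main Y (by rw [h1.1, hX, hY, mul_assoc])

/-- If the class number of `R` is odd and units of `R` that are norms are norms of units, every
class of order two of `S` contains an ideal fixed by conjugation. -/
theorem exists_conj_eq_self [Fintype (ClassGroup R)] (hodd : Odd (Fintype.card (ClassGroup R)))
    (hunit : ∀ u : Rˣ, (∃ x y : S, y ≠ 0 ∧ x * σ x = algebraMap R S u * (y * σ y)) →
      ∃ η : Sˣ, (η : S) * σ η = algebraMap R S u)
    (c : ClassGroup S) (hc : c ^ 2 = 1) :
    ∃ I : (Ideal S)⁰, (I : Ideal S).conj σ = I ∧ ClassGroup.mk0 I = c := by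
  obtain ⟨⟨I, hI⟩, rfl⟩ := ClassGroup.mk0_surjective c
  have hI0 : I ≠ ⊥ := mem_nonZeroDivisors_iff_ne_zero.1 hI
  rw [← map_pow, SubmonoidClass.mk_pow, ClassGroup.mk0_eq_one_iff] at hc
  obtain ⟨g, hg⟩ := hc
  rw [Ideal.submodule_span_eq] at hg
  have hg0 : g ≠ 0 := by
    rintro rfl
    rw [Ideal.span_singleton_eq_bot.2 rfl] at hg
    exact hI0 (pow_eq_zero_iff two_ne_zero |>.1 hg)
  obtain ⟨N, hN⟩ := h.exists_norm_ideal I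
  obtain ⟨r, hr⟩ := h.exists_norm g
  have hN2 : N ^ 2 = Ideal.span {r} := by
    apply h.map_ideal_injective
    rw [Ideal.map_pow, hN, mul_pow, ← conj_pow, hg, conj_span_singleton, Ideal.map_span,
      Set.image_singleton, hr, Ideal.span_singleton_mul_span_singleton]
  obtain ⟨n, hn⟩ := Ideal.IsPrincipal.of_isPrincipal_pow_of_coprime (n := 2)
    (Nat.coprime_two_left.2 hodd) (I := N) ⟨r, by rw [hN2]⟩
  rw [Ideal.submodule_span_eq] at hn
  have hassoc : Associated r (n ^ 2) := by
    rw [← Ideal.span_singleton_eq_span_singleton, ← Ideal.span_singleton_pow, ← hn, hN2]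
  obtain ⟨u, hu⟩ := hassoc
  have hnn : algebraMap R S n * σ (algebraMap R S n) = algebraMap R S u * (g * σ g) := by
    rw [h.map_algebraMap, ← hr, ← map_mul, ← map_mul, mul_comm (u : R), hu, pow_two]
  obtain ⟨η, hη⟩ := hunit u ⟨_, g, hg0, hnn⟩
  obtain ⟨b, hb0, hb⟩ := h.hilbert90 (x := algebraMap R S n) (y := g * η)
    (mul_ne_zero hg0 η.ne_zero) (by rw [hnn, ← hη, map_mul]; ring)
  have hIN : I * I.conj σ = Ideal.span {algebraMap R S n} := by
    rw [← hN, hn, Ideal.map_span, Set.image_singleton]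
  have hbI0 : Ideal.span {b} * I ≠ 0 :=
    mul_ne_zero (by rwa [Ne, Ideal.zero_eq_bot, Ideal.span_singleton_eq_bot]) hI0
  refine ⟨⟨Ideal.span {b} * I, mem_nonZeroDivisors_of_ne_zero hbI0⟩, ?_, ?_⟩
  · change (Ideal.span {b} * I).conj σ = Ideal.span {b} * I
    apply mul_left_cancel₀ hI0
    calc I * (Ideal.span {b} * I).conj σ = Ideal.span {algebraMap R S n * σ b} := by
          rw [conj_mul, conj_span_singleton, mul_left_comm, hIN,
            Ideal.span_singleton_mul_span_singleton, mul_comm]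
      _ = Ideal.span {g} * Ideal.span {b} := by
          rw [hb, Ideal.span_singleton_mul_span_singleton,
            Ideal.span_singleton_eq_span_singleton]
          exact ⟨η⁻¹, by rw [mul_right_comm, mul_assoc g, Units.mul_inv, mul_one]⟩
      _ = I * (Ideal.span {b} * I) := by rw [← hg]; ring
  · rw [ClassGroup.mk0_eq_mk0_iff]
    exact ⟨1, b, one_ne_zero, hb0, by simp⟩

end IsQuadConj

namespace IsQuadConj

open UniqueFactorizationMonoid

section Units

variable {R S : Type*} [CommRing R] [CommRing S] [IsDomain R] [IsDomain S]
  [Algebra R S] {σ : S ≃+* S} (h : IsQuadConj R σ)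

/-- The units of norm one with respect to a conjugation. -/
def normOneUnits (σ : S ≃+* S) : Subgroup Sˣ :=
  ((MonoidHom.id Sˣ) * Units.map (σ : S →* S)).ker

theorem mem_normOneUnits {η : Sˣ} : η ∈ normOneUnits σ ↔ (η : S) * σ η = 1 := by
  rw [normOneUnits, MonoidHom.mem_ker, Units.ext_iff]
  simp

include h

theorem exists_unit_norm (w : Sˣ) : ∃ u : Rˣ, algebraMap R S u = w * σ w := by
  obtain ⟨r, hr⟩ := h.exists_norm (w : S)
  obtain ⟨s, hs⟩ := h.exists_norm ((w⁻¹ : Sˣ) : S)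
  have : r * s = 1 := by
    apply h.inj
    rw [map_mul, hr, hs, map_one, mul_mul_mul_comm, ← map_mul, Units.mul_inv, map_one, one_mul]
  exact ⟨Units.mkOfMulEqOne r s this, hr⟩

variable (hnorm : ∀ u : Rˣ, (∃ x y : S, y ≠ 0 ∧ x * σ x = algebraMap R S u * (y * σ y)) →
  ∃ v, u = v ^ 2)
include hnorm

theorem exists_unit_norm_sq (w : Sˣ) : ∃ v : Rˣ, algebraMap R S v ^ 2 = w * σ w := by
  obtain ⟨u, hu⟩ := h.exists_unit_norm w
  obtain ⟨v, rfl⟩ := hnorm u ⟨w, 1, one_ne_zero, by simp [hu]⟩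
  exact ⟨v, by rw [← hu]; simp⟩

theorem exists_eq_mul_normOne (w : Sˣ) : ∃ (v : Rˣ) (z : Sˣ), z ∈ normOneUnits σ ∧
    w = Units.map (algebraMap R S : R →* S) v * z := by
  obtain ⟨v, hv⟩ := h.exists_unit_norm_sq hnorm w
  refine ⟨v, (Units.map (algebraMap R S : R →* S) v)⁻¹ * w, ?_, by simp⟩
  have h1 : algebraMap R S ((v⁻¹ : Rˣ) : R) * algebraMap R S v = 1 := by
    rw [← map_mul]; simp
  rw [mem_normOneUnits, ← map_inv]
  simp only [Units.val_mul, Units.coe_map, MonoidHom.coe_coe, map_mul, h.map_algebraMap]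
  rw [mul_mul_mul_comm, ← hv]
  linear_combination (algebraMap R S ((v⁻¹ : Rˣ) : R) * algebraMap R S v + 1) * h1

theorem mem_normOneUnits_of_sq (hneg : ∀ v : Rˣ, -1 ≠ v ^ 2) {w : Sˣ}
    (hw : w ^ 2 ∈ normOneUnits σ) : w ∈ normOneUnits σ := by
  obtain ⟨v, hv⟩ := h.exists_unit_norm_sq hnorm w
  rw [mem_normOneUnits] at hw ⊢
  have h1 : ((w : S) * σ w) ^ 2 = 1 := by rw [← hw]; simp; ring
  rcases mul_self_eq_one_iff.1 (by rw [← pow_two, h1] : (w : S) * σ w * (w * σ w) = 1) with h2 | h2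
  · exact h2
  · refine absurd (Units.ext (h.inj ?_)) (hneg v)
    simp [hv, h2]

theorem relIndex_normOneUnits
    (hU : (powMonoidHom 2 : Sˣ →* Sˣ).range.index = 16) (ε : Rˣ)
    (hε : ∀ u : Rˣ, ∃ v, u = v ^ 2 ∨ u = -v ^ 2 ∨ u = ε * v ^ 2 ∨ u = -(ε * v ^ 2))
    (hε' : ∀ v, ε ≠ v ^ 2 ∧ ε ≠ -v ^ 2) :
    (powMonoidHom 2 : Sˣ →* Sˣ).range.relIndex (normOneUnits σ) = 8 := by
  set Q := (powMonoidHom 2 : Sˣ →* Sˣ).range with hQ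
  set E : Sˣ := Units.map (algebraMap R S : R →* S) ε with hE
  have hsq : ∀ x : Sˣ, x ^ 2 ∈ Q ⊔ normOneUnits σ := fun x => Subgroup.mem_sup_left ⟨x, rfl⟩
  have hone : ∀ z ∈ normOneUnits σ, z ∈ Q ⊔ normOneUnits σ := fun z hz => Subgroup.mem_sup_right hz
  have hm1 : (-1 : Sˣ) ∈ Q ⊔ normOneUnits σ := hone _ (mem_normOneUnits.2 (by simp))
  have hEn : E ∉ Q ⊔ normOneUnits σ := by
    intro hmem
    obtain ⟨_, ⟨w, rfl⟩, z, hz, hwz⟩ := Subgroup.mem_sup.1 hmem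
    obtain ⟨v, hv⟩ := h.exists_unit_norm_sq hnorm w
    rw [mem_normOneUnits] at hz
    have h0 : (algebraMap R S ε) = (w : S) ^ 2 * z := by
      have := congrArg Units.val hwz
      simpa [hE] using this.symm
    have h1 : (algebraMap R S ε) ^ 2 = (algebraMap R S (v ^ 2 : Rˣ)) ^ 2 := by
      have h2 : σ (algebraMap R S ε) = σ ((w : S) ^ 2 * z) := by rw [h0]
      rw [h.map_algebraMap] at h2
      rw [Units.val_pow_eq_pow_val, map_pow, hv, pow_two (algebraMap R S ε)]
      nth_rw 1 [h0]
      rw [h2, map_mul, map_pow]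
      linear_combination (w : S) ^ 2 * σ w ^ 2 * hz
    rcases sq_eq_sq_iff_eq_or_eq_neg.1 h1 with h2 | h2
    · exact (hε' v).1 (Units.ext (h.inj h2))
    · exact (hε' v).2 (Units.ext (h.inj (by rw [h2]; simp)))
  have hind : (Q ⊔ normOneUnits σ).index = 2 := by
    rw [Subgroup.index_eq_two_iff]
    refine ⟨E, fun b => ?_⟩
    have key : b ∈ Q ⊔ normOneUnits σ ∨ b * E ∈ Q ⊔ normOneUnits σ := by
      obtain ⟨v, z, hz, rfl⟩ := h.exists_eq_mul_normOne hnorm b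
      have hz' := hone z hz
      obtain ⟨v', hv⟩ := hε v
      have e1 : ∀ x : Rˣ, Units.map (algebraMap R S : R →* S) (-x) =
          -1 * Units.map (algebraMap R S : R →* S) x := by
        intro x; ext; simp
      rcases hv with rfl | rfl | rfl | rfl
      · left; rw [map_pow]; exact mul_mem (hsq _) hz'
      · left; rw [e1, map_pow]; exact mul_mem (mul_mem hm1 (hsq _)) hz'
      · right
        convert mul_mem (hsq (E * Units.map (algebraMap R S : R →* S) v')) hz' using 1
        rw [map_mul, map_pow, mul_pow]
        simp only [← hE]
        rw [pow_two E]; ac_rfl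
      · right
        convert mul_mem (mul_mem hm1 (hsq (E * Units.map (algebraMap R S : R →* S) v'))) hz' using 1
        rw [e1, map_mul, map_pow, mul_pow]
        simp only [← hE]
        rw [pow_two E]; ac_rfl
    by_cases hb : b ∈ Q ⊔ normOneUnits σ
    · exact Or.inr ⟨hb, fun hbE => hEn ((Subgroup.mul_mem_cancel_left _ hb).1 hbE)⟩
    · exact Or.inl ⟨key.resolve_left hb, hb⟩
  have h3 := Subgroup.relIndex_mul_index (H := Q) (K := Q ⊔ normOneUnits σ) le_sup_left
  rw [hind, hU] at h3
  have h4 : Q.relIndex (Q ⊔ normOneUnits σ) = Q.relIndex (normOneUnits σ) :=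
    Subgroup.relIndex_sup_left _ _
  omega

end Units

section Count

open Classical in
/-- The parity of the valuation of an ideal at a prime. -/
noncomputable def parity {S : Type*} [CommRing S] [IsDedekindDomain S] (P I : Ideal S) : ZMod 2 :=
  ((normalizedFactors I).count P : ℕ)

variable {R S : Type*} [CommRing R] [CommRing S] [IsDedekindDomain R] [IsDedekindDomain S]
  [Algebra R S] {σ : S ≃+* S}

theorem parity_mul (P : Ideal S) {I J : Ideal S} (hI : I ≠ ⊥) (hJ : J ≠ ⊥) :
    parity P (I * J) = parity P I + parity P J := by
  classical
  rw [parity, parity, parity, normalizedFactors_mul hI hJ, Multiset.count_add, Nat.cast_add]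

theorem parity_pow (P I : Ideal S) (n : ℕ) : parity P (I ^ n) = n * parity P I := by
  classical
  rw [parity, parity, normalizedFactors_pow, Multiset.count_nsmul, Nat.cast_mul]

theorem parity_top (P : Ideal S) : parity P ⊤ = 0 := by
  rw [parity, ← Ideal.one_eq_top, normalizedFactors_one]; simp

theorem parity_prod_primes (P : Ideal S) (s : Finset (Ideal S)) (hs : ∀ Q ∈ s, Prime Q)
    [Decidable (P ∈ s)] : parity P (∏ Q ∈ s, Q) = if P ∈ s then 1 else 0 := by
  classical
  have h1 : (∏ Q ∈ s, Q) = s.val.prod := by rw [Finset.prod, Multiset.map_id']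
  rw [parity, h1, normalizedFactors_prod_of_prime (fun Q hQ => hs Q hQ),
    Multiset.count_eq_of_nodup s.nodup]
  simp only [Finset.mem_val]
  split_ifs <;> simp

theorem parity_conj (h : IsQuadConj R σ) {P : Ideal S} (hP : P ∈ ramifiedPrimes R S)
    (b : Ideal R) (hb : b ≠ ⊥) : parity P (b.map (algebraMap R S)) = 0 := by
  classical
  obtain ⟨hPp, hP0, hPr⟩ := hP
  have hPP := Ideal.prime_of_isPrime hP0 hPp
  induction b using UniqueFactorizationMonoid.induction_on_prime with
  | h₁ => exact absurd rfl hb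
  | h₂ I hI => rw [Ideal.isUnit_iff.1 hI, Ideal.map_top, parity_top]
  | h₃ I q hI hq ih =>
    rw [Ideal.map_mul, parity_mul P (h.map_ne_bot hq.ne_zero) (h.map_ne_bot hI), ih hI, add_zero]
    by_cases hqP : q = P.comap (algebraMap R S)
    · rw [hqP, hPr, parity_pow]
      change (2 : ZMod 2) * _ = 0
      rw [show (2 : ZMod 2) = 0 from rfl, zero_mul]
    · rw [parity, Multiset.count_eq_zero_of_notMem, Nat.cast_zero]
      intro hmem
      apply hqP
      have := Ideal.isPrime_of_prime hq
      exact (this.isMaximal hq.ne_zero).eq_of_le (Ideal.comap_ne_top _ hPp.ne_top)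
        (Ideal.map_le_iff_le_comap.1 (Ideal.dvd_iff_le.1 (dvd_of_mem_normalizedFactors hmem)))

/-- The product of the ramified primes indexed by a vector of parities. -/
noncomputable def ramifiedProd [Fintype (ramifiedPrimes R S)]
    (e : ramifiedPrimes R S → ZMod 2) : Ideal S :=
  ∏ P : ramifiedPrimes R S, (P : Ideal S) ^ (e P).val

theorem ramifiedProd_ne_bot [Fintype (ramifiedPrimes R S)]
    (e : ramifiedPrimes R S → ZMod 2) : ramifiedProd e ≠ ⊥ := by
  rw [ramifiedProd, ← Ideal.zero_eq_bot, Finset.prod_ne_zero_iff]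
  exact fun P _ => pow_ne_zero _ P.2.2.1

theorem parity_ramifiedProd [Fintype (ramifiedPrimes R S)]
    (e : ramifiedPrimes R S → ZMod 2) (P : ramifiedPrimes R S) :
    parity (P : Ideal S) (ramifiedProd e) = e P := by
  classical
  have h1 : ramifiedProd e = ∏ Q ∈ (Finset.univ.filter fun P => e P = 1).map
      (Function.Embedding.subtype (· ∈ ramifiedPrimes R S)), Q := by
    rw [Finset.prod_map, ramifiedProd, Finset.prod_filter]
    refine Finset.prod_congr rfl fun Q _ => ?_
    rcases (by decide : ∀ x : ZMod 2, x = 0 ∨ x = 1) (e Q) with h | h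
    · simp [h]
    · simp [h, show ZMod.val (1 : ZMod 2) = 1 from rfl]
  rw [h1, parity_prod_primes]
  · simp
    generalize e P = x
    revert x
    decide
  · simp only [Finset.mem_map]
    rintro _ ⟨Q, -, rfl⟩
    exact Ideal.prime_of_isPrime Q.2.2.1 Q.2.1

theorem exists_eq_ramifiedProd_mul (h : IsQuadConj R σ) [Fintype (ramifiedPrimes R S)]
    (I : Ideal S) (hI0 : I ≠ ⊥) (hI : I.conj σ = I) :
    ∃ b : Ideal R, b ≠ ⊥ ∧
      I = ramifiedProd (fun P : ramifiedPrimes R S => parity (P : Ideal S) I) *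
        b.map (algebraMap R S) := by
  classical
  obtain ⟨s, b, hs, hb⟩ := h.exists_eq_prod_mul_map I hI0 hI
  have hb0 : b ≠ ⊥ := by rintro rfl; exact hI0 (by rw [hb, Ideal.map_bot, Ideal.mul_bot])
  have hsp : ∀ Q ∈ s, Prime Q := fun Q hQ => Ideal.prime_of_isPrime (hs hQ).2.1 (hs hQ).1
  refine ⟨b, hb0, ?_⟩
  have h1 : ∀ P : ramifiedPrimes R S,
      parity (P : Ideal S) I = if (P : Ideal S) ∈ s then 1 else 0 := by
    intro P
    rw [hb, parity_mul _ _ (h.map_ne_bot hb0), parity_prod_primes _ _ hsp, parity_conj h P.2 _ hb0,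
      add_zero]
    rw [← Ideal.zero_eq_bot, Finset.prod_ne_zero_iff]
    exact fun Q hQ => (hsp Q hQ).ne_zero
  simp only [h1]
  rw [hb]
  congr 1
  have h2 : s = (Finset.univ.filter fun P : ramifiedPrimes R S => (P : Ideal S) ∈ s).map
      (Function.Embedding.subtype (· ∈ ramifiedPrimes R S)) := by
    ext Q
    simp
    exact fun hQ => hs hQ
  rw [ramifiedProd]
  nth_rw 1 [h2]
  rw [Finset.prod_map, Finset.prod_filter]
  refine Finset.prod_congr rfl fun Q _ => ?_
  split_ifs <;> simp [show ZMod.val (1 : ZMod 2) = 1 from rfl]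

theorem conj_eq_of_mem_ramifiedPrimes (h : IsQuadConj R σ) {P : Ideal S}
    (hP : P ∈ ramifiedPrimes R S) : P.conj σ = P := by
  obtain ⟨hPp, hP0, hPr⟩ := hP
  exact h.conj_eq_of_ramified hP0 hPr

theorem conj_ramifiedProd (h : IsQuadConj R σ) [Fintype (ramifiedPrimes R S)]
    (e : ramifiedPrimes R S → ZMod 2) : (ramifiedProd e).conj σ = ramifiedProd e := by
  rw [ramifiedProd, Ideal.conj, ← Ideal.mapHom_apply, map_prod]
  refine Finset.prod_congr rfl fun P _ => ?_
  rw [map_pow]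
  congr 1
  exact conj_eq_of_mem_ramifiedPrimes h P.2

theorem exists_generator (h : IsQuadConj R σ) {η : Sˣ} (hη : η ∈ normOneUnits σ) :
    ∃ α : S, α ≠ 0 ∧ η * σ α = α := by
  simpa using h.hilbert90 (x := (η : S)) (y := 1) one_ne_zero
    (by rw [mem_normOneUnits.1 hη]; simp)

theorem conj_span_of_generator {η : Sˣ} {α : S} (hα : η * σ α = α) :
    (Ideal.span {α}).conj σ = Ideal.span {α} := by
  rw [conj_span_singleton, Ideal.span_singleton_eq_span_singleton]
  exact ⟨η, by rw [mul_comm, hα]⟩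

theorem parity_generator_eq (h : IsQuadConj R σ) {η : Sˣ} {α β : S} (hα0 : α ≠ 0) (hβ0 : β ≠ 0)
    (hα : η * σ α = α) (hβ : η * σ β = β) {P : Ideal S} (hP : P ∈ ramifiedPrimes R S) :
    parity P (Ideal.span {α}) = parity P (Ideal.span {β}) := by
  have even_of : ∀ (x y : S), x ≠ 0 → y ≠ 0 → σ (x * y) = x * y →
      parity P (Ideal.span {x}) + parity P (Ideal.span {y}) = 0 := by
    intro x y hx hy hxy
    obtain ⟨r, hr⟩ := (h.fix_iff _).1 hxy
    have h0 : r ≠ 0 := by rintro rfl; rw [map_zero, eq_comm] at hr; exact mul_ne_zero hx hy hr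
    rw [← parity_mul, Ideal.span_singleton_mul_span_singleton, ← hr, ← Set.image_singleton,
      ← Ideal.map_span, parity_conj h hP]
    · simpa
    · simpa
    · simpa
  have hσβ : σ β ≠ 0 := by simpa
  have h1 := even_of α (σ β) hα0 hσβ (by
    rw [map_mul, h.invol]
    nth_rw 1 [← hβ]; nth_rw 2 [← hα]; ring)
  have h2 := even_of β (σ β) hβ0 hσβ (by rw [map_mul, h.invol, mul_comm])
  exact add_right_cancel (h1.trans h2.symm)

/-- The parities of the valuations, at the ramified primes, of an element `α` with
`η = α / σ α`. -/
noncomputable def parityHom (h : IsQuadConj R σ) :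
    normOneUnits σ →* Multiplicative (ramifiedPrimes R S → ZMod 2) :=
  MonoidHom.mk' (fun η => Multiplicative.ofAdd fun P =>
    parity (P : Ideal S) (Ideal.span {(exists_generator h η.2).choose})) <| by
    intro η θ
    rw [← ofAdd_add]
    congr 1
    funext P
    obtain ⟨h1, h1'⟩ := (exists_generator h η.2).choose_spec
    obtain ⟨h2, h2'⟩ := (exists_generator h θ.2).choose_spec
    obtain ⟨h3, h3'⟩ := (exists_generator h (η * θ).2).choose_spec
    rw [Pi.add_apply, ← parity_mul _ (by simpa) (by simpa),
      Ideal.span_singleton_mul_span_singleton]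
    refine parity_generator_eq h h3 (mul_ne_zero h1 h2) h3' ?_ P.2
    conv_rhs => rw [← h1', ← h2']
    rw [map_mul]
    push_cast
    ring

theorem parityHom_apply (h : IsQuadConj R σ) (η : normOneUnits σ) {α : S} (hα0 : α ≠ 0)
    (hα : ((η : Sˣ) : S) * σ α = α) (P : ramifiedPrimes R S) :
    (parityHom h η).toAdd P = parity (P : Ideal S) (Ideal.span {α}) := by
  obtain ⟨h1, h1'⟩ := (exists_generator h η.2).choose_spec
  exact parity_generator_eq h h1 hα0 h1' hα P.2

variable [Fintype (ClassGroup R)]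

theorem exists_pow_card_eq_span (b : Ideal R) :
    ∃ r : R, (b.map (algebraMap R S)) ^ Fintype.card (ClassGroup R) =
      Ideal.span {algebraMap R S r} := by
  by_cases hb : b = ⊥
  · refine ⟨0, ?_⟩
    rw [hb, Ideal.map_bot, ← Ideal.zero_eq_bot, zero_pow Fintype.card_ne_zero]; simp
  have h1 : ClassGroup.mk0 (⟨b, mem_nonZeroDivisors_of_ne_zero hb⟩ ^
      Fintype.card (ClassGroup R) : (Ideal R)⁰) = 1 := by
    rw [map_pow, pow_card_eq_one]
  rw [SubmonoidClass.mk_pow, ClassGroup.mk0_eq_one_iff] at h1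
  obtain ⟨r, hr⟩ := h1
  exact ⟨r, by rw [← Ideal.map_pow, hr, Ideal.submodule_span_eq, Ideal.map_span,
    Set.image_singleton]⟩

variable (hodd : Odd (Fintype.card (ClassGroup R)))
include hodd

theorem parity_pow_card (P I : Ideal S) :
    parity P (I ^ Fintype.card (ClassGroup R)) = parity P I := by
  rw [parity_pow, (ZMod.natCast_eq_one_iff_odd).2 hodd, one_mul]

theorem ker_parityHom (h : IsQuadConj R σ)
    (hnorm : ∀ u : Rˣ, (∃ x y : S, y ≠ 0 ∧ x * σ x = algebraMap R S u * (y * σ y)) → ∃ v, u = v ^ 2)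
    (hneg : ∀ v : Rˣ, -1 ≠ v ^ 2) [Fintype (ramifiedPrimes R S)] :
    (parityHom h).ker = (powMonoidHom 2 : Sˣ →* Sˣ).range.subgroupOf (normOneUnits σ) := by
  ext η
  rw [MonoidHom.mem_ker, Subgroup.mem_subgroupOf]
  constructor
  · intro hη
    obtain ⟨α, hα0, hα⟩ := exists_generator h η.2
    obtain ⟨b, hb0, hb⟩ := exists_eq_ramifiedProd_mul h (Ideal.span {α}) (by simpa)
      (conj_span_of_generator hα)
    have h1 : (fun P : ramifiedPrimes R S => parity (P : Ideal S) (Ideal.span {α})) = 0 := by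
      funext P
      rw [← parityHom_apply h η hα0 hα P, hη]; rfl
    have h2 : ramifiedProd (0 : ramifiedPrimes R S → ZMod 2) = (1 : Ideal S) := by
      simp [ramifiedProd]
    rw [h1, h2, one_mul] at hb
    obtain ⟨r, hr⟩ := exists_pow_card_eq_span (S := S) b
    rw [← hb, Ideal.span_singleton_pow, Ideal.span_singleton_eq_span_singleton] at hr
    obtain ⟨u, hu⟩ := hr
    obtain ⟨v, z, hz, hvz⟩ := h.exists_eq_mul_normOne hnorm u⁻¹
    have hz' := mem_normOneUnits.1 hz
    set m := Fintype.card (ClassGroup R)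
    have hαr : α ^ m = algebraMap R S (r * v) * z := by
      have : α ^ m = algebraMap R S r * ((u⁻¹ : Sˣ) : S) := by
        rw [← hu, mul_assoc, Units.mul_inv, mul_one]
      rw [this, hvz]; simp [mul_assoc]
    have hηm : (η : Sˣ) ^ m = z ^ 2 := by
      ext
      have h3 : ((η : Sˣ) : S) ^ m * (algebraMap R S (r * v) * σ z) =
          algebraMap R S (r * v) * z := by
        rw [← hαr, ← h.map_algebraMap (r * v), ← map_mul, ← hαr, map_pow, ← mul_pow, hα]
      have h4 : algebraMap R S (r * v) ≠ 0 := by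
        intro h0
        rw [h0, zero_mul] at hαr
        exact pow_ne_zero _ hα0 hαr
      push_cast
      apply mul_left_cancel₀ h4
      linear_combination (z : S) * h3 - algebraMap R S (r * v) * ((η : Sˣ) : S) ^ m * hz'
    obtain ⟨k, hk⟩ := hodd
    refine ⟨z * (η : Sˣ)⁻¹ ^ k, ?_⟩
    rw [powMonoidHom_apply, mul_pow, ← hηm]
    rw [hk, ← pow_mul, mul_comm k 2, pow_succ, inv_pow, mul_right_comm, mul_inv_cancel, one_mul]
  · rintro ⟨z, hz⟩
    have hz1 : z ∈ normOneUnits σ :=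
      h.mem_normOneUnits_of_sq hnorm hneg (by rw [show z ^ 2 = η from hz]; exact η.2)
    apply Multiplicative.toAdd.injective
    funext P
    rw [parityHom_apply h η z.ne_zero _ P]
    · rw [Ideal.span_singleton_eq_top.2 z.isUnit, parity_top]; rfl
    · rw [← hz]
      have := mem_normOneUnits.1 hz1
      simp
      linear_combination (z : S) * this

omit hodd in
theorem mk0_pow_card_eq (h : IsQuadConj R σ) [Fintype (ramifiedPrimes R S)]
    (I : (Ideal S)⁰) (hI : (I : Ideal S).conj σ = I) :
    ClassGroup.mk0 I ^ Fintype.card (ClassGroup R) =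
      ClassGroup.mk0 ⟨ramifiedProd fun P : ramifiedPrimes R S => parity (P : Ideal S) I,
        mem_nonZeroDivisors_of_ne_zero (ramifiedProd_ne_bot _)⟩ ^
          Fintype.card (ClassGroup R) := by
  obtain ⟨b, hb0, hb⟩ := exists_eq_ramifiedProd_mul h I (nonZeroDivisors.coe_ne_zero I) hI
  have hI' : I = ⟨ramifiedProd fun P : ramifiedPrimes R S => parity (P : Ideal S) I,
        mem_nonZeroDivisors_of_ne_zero (ramifiedProd_ne_bot _)⟩ *
      ⟨b.map (algebraMap R S), mem_nonZeroDivisors_of_ne_zero (h.map_ne_bot hb0)⟩ :=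
    Subtype.ext hb
  conv_lhs => rw [hI', map_mul, mul_pow]
  convert mul_one _
  rw [← map_pow, SubmonoidClass.mk_pow, ClassGroup.mk0_eq_one_iff]
  obtain ⟨r, hr⟩ := exists_pow_card_eq_span (S := S) b
  exact ⟨_, hr⟩

omit hodd in
theorem mk0_conj_self_pow (h : IsQuadConj R σ) (I : (Ideal S)⁰) (hI : (I : Ideal S).conj σ = I) :
    (ClassGroup.mk0 I ^ Fintype.card (ClassGroup R)) ^ 2 = 1 := by
  obtain ⟨N, hN⟩ := h.exists_norm_ideal (I : Ideal S)
  obtain ⟨r, hr⟩ := exists_pow_card_eq_span (S := S) N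
  rw [← map_pow, ← map_pow, ClassGroup.mk0_eq_one_iff]
  refine ⟨algebraMap R S r, ?_⟩
  push_cast
  rw [← pow_mul, mul_comm, pow_mul, pow_two]
  nth_rw 2 [← hI]
  rw [← hN, hr]

/-- The map sending a vector of parities to the class, made of exponent two, of the corresponding
product of ramified primes. -/
noncomputable def ramifiedClass (h : IsQuadConj R σ) [Fintype (ramifiedPrimes R S)] :
    Multiplicative (ramifiedPrimes R S → ZMod 2) →* ClassGroup S :=
  MonoidHom.mk' (fun e => ClassGroup.mk0 ⟨ramifiedProd e.toAdd,
    mem_nonZeroDivisors_of_ne_zero (ramifiedProd_ne_bot _)⟩ ^ Fintype.card (ClassGroup R)) <| by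
    intro e f
    rw [← mul_pow, ← map_mul, mk0_pow_card_eq h (_ * _)]
    · congr 3
      simp only [Submonoid.coe_mul]
      congr 1
      funext P
      rw [parity_mul _ (ramifiedProd_ne_bot _) (ramifiedProd_ne_bot _), parity_ramifiedProd,
        parity_ramifiedProd]
      rfl
    · simp only [Submonoid.coe_mul]
      rw [conj_mul, conj_ramifiedProd h, conj_ramifiedProd h]

theorem range_parityHom (h : IsQuadConj R σ) [Fintype (ramifiedPrimes R S)] :
    (parityHom h).range = (ramifiedClass h).ker := by
  ext e
  rw [MonoidHom.mem_range, MonoidHom.mem_ker]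
  constructor
  · rintro ⟨η, rfl⟩
    obtain ⟨α, hα0, hα⟩ := exists_generator h η.2
    have h1 := mk0_pow_card_eq h ⟨Ideal.span {α}, mem_nonZeroDivisors_of_ne_zero (by simpa)⟩
      (conj_span_of_generator hα)
    have h2 : (parityHom h η).toAdd =
        fun P : ramifiedPrimes R S => parity (P : Ideal S) (Ideal.span {α}) :=
      funext (parityHom_apply h η hα0 hα)
    change ClassGroup.mk0 ⟨ramifiedProd (parityHom h η).toAdd, _⟩ ^ _ = 1
    simp only [h2]
    rw [← h1, ← map_pow, SubmonoidClass.mk_pow, ClassGroup.mk0_eq_one_iff]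
    exact ⟨_, Ideal.span_singleton_pow _ _⟩
  · intro he
    change ClassGroup.mk0 ⟨ramifiedProd e.toAdd, _⟩ ^ _ = 1 at he
    rw [← map_pow, SubmonoidClass.mk_pow, ClassGroup.mk0_eq_one_iff] at he
    obtain ⟨α, hα⟩ := he
    rw [Ideal.submodule_span_eq] at hα
    have hα0 : α ≠ 0 := by
      rintro rfl
      rw [Ideal.span_singleton_eq_bot.2 rfl] at hα
      exact pow_ne_zero _ (ramifiedProd_ne_bot e.toAdd) hα
    have hc : Ideal.span {σ α} = Ideal.span {α} := by
      rw [← conj_span_singleton, ← hα, conj_pow, conj_ramifiedProd h]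
    obtain ⟨η, hη⟩ := Ideal.span_singleton_eq_span_singleton.1 hc
    have hη1 : η ∈ normOneUnits σ := by
      rw [mem_normOneUnits]
      apply mul_left_cancel₀ (show σ α ≠ 0 by simpa)
      have h1 := congrArg σ hη
      rw [map_mul, h.invol] at h1
      rw [← mul_assoc, hη, h1, mul_one]
    refine ⟨⟨η, hη1⟩, Multiplicative.toAdd.injective (funext fun P => ?_)⟩
    rw [parityHom_apply h _ hα0 (by rw [mul_comm, hη]) P, ← hα, parity_pow_card hodd,
      parity_ramifiedProd]

theorem range_ramifiedClass (h : IsQuadConj R σ)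
    (hnorm : ∀ u : Rˣ, (∃ x y : S, y ≠ 0 ∧ x * σ x = algebraMap R S u * (y * σ y)) → ∃ v, u = v ^ 2)
    [Fintype (ramifiedPrimes R S)] (c : ClassGroup S) :
    c ∈ (ramifiedClass h).range ↔ c ^ 2 = 1 := by
  constructor
  · rintro ⟨e, rfl⟩
    exact mk0_conj_self_pow h _ (conj_ramifiedProd h _)
  · intro hc
    obtain ⟨I, hI, rfl⟩ := h.exists_conj_eq_self hodd (fun u hu => by
      obtain ⟨v, rfl⟩ := hnorm u hu
      exact ⟨Units.map (algebraMap R S : R →* S) v, by simp [h.map_algebraMap, pow_two]⟩) c hc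
    refine ⟨Multiplicative.ofAdd fun P => parity (P : Ideal S) I, ?_⟩
    change ClassGroup.mk0 _ ^ _ = _
    refine (mk0_pow_card_eq h I hI).symm.trans ?_
    obtain ⟨k, hk⟩ := hodd
    rw [hk, pow_succ, pow_mul, hc, one_pow, one_mul]

/-- The ambiguous class number formula for a quadratic extension whose base has odd class number
and unit rank one, and in which the units that are norms are squares. -/
theorem card_two_torsion (h : IsQuadConj R σ)
    (hnorm : ∀ u : Rˣ, (∃ x y : S, y ≠ 0 ∧ x * σ x = algebraMap R S u * (y * σ y)) → ∃ v, u = v ^ 2)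
    (hneg : ∀ v : Rˣ, -1 ≠ v ^ 2)
    (hU : (powMonoidHom 2 : Sˣ →* Sˣ).range.index = 16) (ε : Rˣ)
    (hε : ∀ u : Rˣ, ∃ v, u = v ^ 2 ∨ u = -v ^ 2 ∨ u = ε * v ^ 2 ∨ u = -(ε * v ^ 2))
    (hε' : ∀ v, ε ≠ v ^ 2 ∧ ε ≠ -v ^ 2) (hfin : (ramifiedPrimes R S).Finite) :
    Nat.card {c : ClassGroup S // c ^ 2 = 1} * 8 = 2 ^ (ramifiedPrimes R S).ncard := by
  have := hfin.fintype
  have h1 : Nat.card {c : ClassGroup S // c ^ 2 = 1} = (ramifiedClass h).ker.index := by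
    rw [Subgroup.index_ker]
    exact Nat.card_congr (Equiv.subtypeEquivRight fun c =>
      (range_ramifiedClass hodd h hnorm c).symm)
  have h2 : Nat.card (ramifiedClass h).ker = 8 := by
    rw [← range_parityHom hodd h, ← Subgroup.index_ker, ker_parityHom hodd h hnorm hneg]
    exact h.relIndex_normOneUnits hnorm hU ε hε hε'
  rw [h1, ← h2, mul_comm, Subgroup.card_mul_index, Nat.card_congr Multiplicative.toAdd,
    Nat.card_fun, Nat.card_zmod]
  rfl

end Count

end IsQuadConj

namespace NumberField.Units

variable (K : Type*) [Field K] [NumberField K]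

/-- Dirichlet's unit theorem as an isomorphism. -/
noncomputable def torsionProdEquiv :
    torsion K × Multiplicative (Fin (rank K) → ℤ) ≃* (𝓞 K)ˣ :=
  MulEquiv.ofBijective
    (MonoidHom.mk' (fun x => (x.1 : (𝓞 K)ˣ) * ∏ i, fundSystem K i ^ x.2.toAdd i) (by
      intro x y
      simp only [Prod.fst_mul, Prod.snd_mul, toAdd_mul, Pi.add_apply, zpow_add,
        Finset.prod_mul_distrib, Subgroup.coe_mul]
      ac_rfl)) (by
    constructor
    · intro x y hxy
      obtain ⟨z, -, hz⟩ := exist_unique_eq_mul_prod K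
        ((x.1 : (𝓞 K)ˣ) * ∏ i, fundSystem K i ^ x.2.toAdd i)
      have h1 := hz (x.1, x.2.toAdd) rfl
      have h2 := hz (y.1, y.2.toAdd) hxy
      rw [← h2] at h1
      exact h1
    · intro x
      obtain ⟨z, hz, -⟩ := exist_unique_eq_mul_prod K x
      exact ⟨(z.1, Multiplicative.ofAdd z.2), hz.symm⟩)

theorem index_range_powMonoidHom_two :
    (powMonoidHom 2 : (𝓞 K)ˣ →* (𝓞 K)ˣ).range.index = 2 ^ (rank K + 1) := by
  set Q := (powMonoidHom 2 : torsion K →* torsion K).range with hQ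
  let red : (Fin (rank K) → ℤ) →+ (Fin (rank K) → ZMod 2) :=
    (Int.castAddHom (ZMod 2)).compLeft _
  let g : torsion K × Multiplicative (Fin (rank K) → ℤ) →*
      (torsion K ⧸ Q) × Multiplicative (Fin (rank K) → ZMod 2) :=
    (QuotientGroup.mk' Q).prodMap (AddMonoidHom.toMultiplicative red)
  have hg : Function.Surjective g := by
    rintro ⟨x, f⟩
    obtain ⟨x, rfl⟩ := QuotientGroup.mk'_surjective Q x
    refine ⟨(x, Multiplicative.ofAdd fun i => ((f.toAdd i).val : ℤ)), Prod.ext rfl ?_⟩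
    apply Multiplicative.toAdd.injective
    funext i
    simp [g, red]
  have hker : (g.comp (torsionProdEquiv K).symm.toMonoidHom).ker =
      (powMonoidHom 2 : (𝓞 K)ˣ →* (𝓞 K)ˣ).range := by
    ext x
    obtain ⟨⟨t, f⟩, rfl⟩ := (torsionProdEquiv K).surjective x
    rw [MonoidHom.mem_ker]
    simp only [MonoidHom.comp_apply, MulEquiv.coe_toMonoidHom, MulEquiv.symm_apply_apply]
    constructor
    · intro h
      obtain ⟨h1, h2⟩ := Prod.ext_iff.1 h
      obtain ⟨s, hs⟩ := (QuotientGroup.eq_one_iff t).1 h1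
      have h3 : ∀ i, ∃ k : ℤ, f.toAdd i = 2 * k := by
        intro i
        have := congrFun (congrArg Multiplicative.toAdd h2) i
        exact (ZMod.intCast_zmod_eq_zero_iff_dvd _ 2).1 this
      choose k hk using h3
      refine ⟨torsionProdEquiv K (s, Multiplicative.ofAdd k), ?_⟩
      rw [powMonoidHom_apply, ← map_pow]
      congr 1
      refine Prod.ext hs (Multiplicative.toAdd.injective (funext fun i => ?_))
      simp [hk]
    · rintro ⟨y, hy⟩
      obtain ⟨⟨s, k⟩, rfl⟩ := (torsionProdEquiv K).surjective y
      rw [powMonoidHom_apply, ← map_pow] at hy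
      rw [← (torsionProdEquiv K).injective hy, map_pow]
      refine Prod.ext ?_ (Multiplicative.toAdd.injective (funext fun i => ?_))
      · change ((QuotientGroup.mk' Q) s) ^ 2 = 1
        rw [← map_pow]
        exact (QuotientGroup.eq_one_iff _).2 ⟨s, rfl⟩
      · change 2 • ((k.toAdd i : ℤ) : ZMod 2) = 0
        rw [two_nsmul]
        exact CharTwo.add_self_eq_zero _
  have hsurj : Function.Surjective (g.comp (torsionProdEquiv K).symm.toMonoidHom) :=
    hg.comp (torsionProdEquiv K).symm.surjective
  rw [← hker, Subgroup.index_ker, MonoidHom.range_eq_top.2 hsurj, Subgroup.card_top, Nat.card_prod,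
    ← Subgroup.index_eq_card, IsCyclic.index_powMonoidHom_range, Nat.gcd_eq_right,
    Nat.card_congr Multiplicative.toAdd, Nat.card_fun, Nat.card_zmod, pow_succ, mul_comm]
  · simp
  · exact even_iff_two_dvd.1 (even_torsionOrder K)

theorem rank_of_isTotallyReal [h : IsTotallyReal K] : rank K + 1 = Module.finrank ℚ K := by
  rw [rank, IsTotallyReal.finrank, ← Nat.add_zero (InfinitePlace.nrRealPlaces K),
    ← IsTotallyReal.nrComplexPlaces_eq_zero K,
    ← InfinitePlace.card_eq_nrRealPlaces_add_nrComplexPlaces]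
  exact Nat.sub_add_cancel (Fintype.card_pos (α := InfinitePlace K))

end NumberField.Units

namespace IsQuadConj

section Quadratic

variable {O : Type*} [CommRing O] [IsDedekindDomain O] {σ : O ≃+* O} (h : IsQuadConj ℤ σ)
include h

theorem intCast_inj {a b : ℤ} : (a : O) = b ↔ a = b :=
  ⟨fun hab => h.inj (by simpa using hab), fun hab => by rw [hab]⟩

theorem exists_intCast_of_fix {x : O} (hx : σ x = x) : ∃ a : ℤ, (a : O) = x := by
  simpa using (h.fix_iff x).1 hx

theorem comap_eq_span {P : Ideal O} [hP : P.IsPrime] {r : ℕ} (hr : r.Prime) (hrP : (r : O) ∈ P) :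
    P.comap (algebraMap ℤ O) = Ideal.span {(r : ℤ)} := by
  have hmax : (Ideal.span {(r : ℤ)}).IsMaximal :=
    PrincipalIdealRing.isMaximal_of_irreducible (Nat.prime_iff_prime_int.1 hr).irreducible
  refine (hmax.eq_of_le (Ideal.comap_ne_top _ hP.ne_top) ?_).symm
  rw [Ideal.span_singleton_le_iff_mem, Ideal.mem_comap]
  simpa

theorem map_comap_eq_span {P : Ideal O} [hP : P.IsPrime] {r : ℕ} (hr : r.Prime)
    (hrP : (r : O) ∈ P) :
    (P.comap (algebraMap ℤ O)).map (algebraMap ℤ O) = Ideal.span {(r : O)} := by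
  rw [h.comap_eq_span hr hrP, Ideal.map_span, Set.image_singleton]
  simp

theorem intCast_mem_iff {P : Ideal O} [hP : P.IsPrime] {r : ℕ} (hr : r.Prime) (hrP : (r : O) ∈ P)
    (a : ℤ) : (a : O) ∈ P ↔ (r : ℤ) ∣ a := by
  rw [← Ideal.mem_span_singleton, ← h.comap_eq_span hr hrP, Ideal.mem_comap]
  simp

theorem ne_bot_of_prime_mem {P : Ideal O} {r : ℕ} (hr : r.Prime) (hrP : (r : O) ∈ P) : P ≠ ⊥ := by
  rintro rfl
  rw [Ideal.mem_bot] at hrP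
  have : ((r : ℤ) : O) = (0 : ℤ) := by simpa using hrP
  have := h.intCast_inj.1 this
  exact hr.ne_zero (by exact_mod_cast this)

theorem exists_prime_mem {r : ℕ} (hr : r.Prime) : ∃ P : Ideal O, P.IsPrime ∧ (r : O) ∈ P := by
  have := h.isIntegral
  have hprime : (Ideal.span {(r : ℤ)}).IsPrime :=
    (Ideal.span_singleton_prime (by exact_mod_cast hr.ne_zero)).2 (Nat.prime_iff_prime_int.1 hr)
  obtain ⟨P, hP, hPr⟩ := Ideal.exists_ideal_over_prime_of_isIntegral_of_isDomain (S := O)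
    (Ideal.span {(r : ℤ)}) (by rw [(RingHom.injective_iff_ker_eq_bot _).1 h.inj]; exact bot_le)
  refine ⟨P, hP, ?_⟩
  have : (r : ℤ) ∈ P.comap (algebraMap ℤ O) := by
    rw [hPr]; exact Ideal.mem_span_singleton_self _
  simpa using this

/-- A prime above which there is an element with norm divisible by it, and coprime trace, splits. -/
theorem ncard_primes_of_split {r : ℕ} (hr : r.Prime) {x : O} {a b : ℤ} (ha : x * σ x = r * a)
    (hb : x + σ x = b) (hrb : ¬ (r : ℤ) ∣ b) :
    {P : Ideal O | P.IsPrime ∧ (r : O) ∈ P}.ncard = 2 := by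
  obtain ⟨P, hP, hrP⟩ := h.exists_prime_mem hr
  have hP0 := h.ne_bot_of_prime_mem hr hrP
  rw [Set.ncard_eq_two]
  refine ⟨P, P.conj σ, ?_, ?_⟩
  · intro heq
    have h1 : x * σ x ∈ P := by rw [ha]; exact P.mul_mem_right _ hrP
    have h2 : x ∈ P ∧ σ x ∈ P := by
      rcases hP.mem_or_mem h1 with h2 | h2
      · exact ⟨h2, by rwa [heq, h.mem_conj] at h2⟩
      · refine ⟨?_, h2⟩
        rwa [← h.mem_conj, ← heq] at h2
    have h3 : x + σ x ∈ P := P.add_mem h2.1 h2.2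
    rw [hb, h.intCast_mem_iff hr hrP] at h3
    exact hrb h3
  · ext Q
    simp only [Set.mem_ofPred_eq, Set.mem_insert_iff, Set.mem_singleton_iff]
    constructor
    · rintro ⟨hQ, hrQ⟩
      exact h.eq_or_eq_conj hP0 (by rw [h.comap_eq_span hr hrP, h.comap_eq_span hr hrQ])
    · rintro (rfl | rfl)
      · exact ⟨hP, hrP⟩
      · exact ⟨h.conj_prime, h.mem_conj.2 (by simpa)⟩

variable {l : ℕ} (hl : l.Prime) {w : O} (hw : w ^ 2 = l) (hσ : σ w = -w)
include hl hw hσ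

theorem sqrt_ne_zero : w ≠ 0 := by
  rintro rfl
  have : ((l : ℤ) : O) = (0 : ℤ) := by simp [← hw]
  have := h.intCast_inj.1 this
  exact hl.ne_zero (by exact_mod_cast this)

theorem exists_sub_conj (x : O) : ∃ k : ℤ, x - σ x = k * w := by
  obtain ⟨m, hm⟩ := h.exists_intCast_of_fix (x := (x - σ x) * w)
    (by rw [map_mul, map_sub, h.invol, hσ]; ring)
  obtain ⟨N, hN⟩ := h.exists_intCast_of_fix (x := (x - σ x) ^ 2)
    (by rw [map_pow, map_sub, h.invol]; ring)
  have h1 : m ^ 2 = N * l := by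
    rw [← h.intCast_inj]
    push_cast
    rw [hm, hN, ← hw]; ring
  have h2 : (l : ℤ) ∣ m := (Nat.prime_iff_prime_int.1 hl).dvd_of_dvd_pow ⟨N, by rw [h1, mul_comm]⟩
  obtain ⟨k, rfl⟩ := h2
  refine ⟨k, mul_right_cancel₀ (h.sqrt_ne_zero hl hw hσ) ?_⟩
  rw [← hm]; push_cast; rw [← hw]; ring

theorem exists_two_mul_eq (x : O) : ∃ a k : ℤ, 2 * x = a + k * w ∧ x + σ x = a := by
  obtain ⟨k, hk⟩ := h.exists_sub_conj hl hw hσ x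
  obtain ⟨a, ha⟩ := h.exists_trace x
  refine ⟨a, k, ?_, by simpa using ha.symm⟩
  have : (a : O) = x + σ x := by simpa using ha
  rw [← hk, this]; ring

theorem eq_span_sqrt {P : Ideal O} [hP : P.IsPrime] (hlP : (l : O) ∈ P) : P = Ideal.span {w} := by
  have hP0 := h.ne_bot_of_prime_mem hl hlP
  have hwP : w ∈ P := hP.mem_of_pow_mem 2 (by rwa [hw])
  have hle : Ideal.span {w} ≤ P := (Ideal.span_singleton_le_iff_mem _).2 hwP
  have hdec := h.decomposition hP0
  rw [h.map_comap_eq_span hl hlP, ← hw, ← Ideal.span_singleton_pow] at hdec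
  rcases hdec with h1 | h1 | h1
  · exact absurd ((Ideal.pow_right_mono hle 2).trans' h1.ge) (not_le_sq hP0)
  · obtain ⟨X, hX⟩ := Ideal.dvd_iff_le.2 hle
    have h2 : P ^ 2 * X ^ 2 = P ^ 2 * 1 := by rw [← mul_pow, ← hX, h1.1, mul_one]
    have h3 : X ^ 2 = 1 := mul_left_cancel₀ (pow_ne_zero 2 hP0) h2
    have h4 : X = 1 := by
      rw [Ideal.one_eq_top, ← Ideal.isUnit_iff]
      exact IsUnit.of_mul_eq_one X (by rw [← pow_two, h3])
    rw [hX, h4, mul_one]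
  · refine absurd (le_antisymm ?_ ?_) h1.2
    · intro x hx
      obtain ⟨k, hk⟩ := h.exists_sub_conj hl hw hσ x
      have h3 : σ x ∈ P := h.mem_conj.1 hx
      have : x = k * w + σ x := by rw [← hk]; ring
      rw [this]
      exact P.add_mem (P.mul_mem_left _ hwP) h3
    · intro x hx
      obtain ⟨k, hk⟩ := h.exists_sub_conj hl hw hσ x
      rw [h.mem_conj]
      have : σ x = x - k * w := by rw [← hk]; ring
      rw [this]
      exact P.sub_mem hx (P.mul_mem_left _ hwP)

theorem ncard_primes_sqrt : {P : Ideal O | P.IsPrime ∧ (l : O) ∈ P}.ncard = 1 := by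
  rw [Set.ncard_eq_one]
  refine ⟨Ideal.span {w}, ?_⟩
  ext P
  simp only [Set.mem_ofPred_eq, Set.mem_singleton_iff]
  constructor
  · rintro ⟨hP, hlP⟩
    exact h.eq_span_sqrt hl hw hσ hlP
  · rintro rfl
    obtain ⟨P, hP, hlP⟩ := h.exists_prime_mem hl
    rw [← h.eq_span_sqrt hl hw hσ hlP]
    exact ⟨hP, hlP⟩

theorem ncard_primes_of_inert {r : ℕ} (hr : r.Prime) (hr2 : r ≠ 2)
    (hrl : ∀ a k : ℤ, (r : ℤ) ∣ a ^ 2 - l * k ^ 2 → (r : ℤ) ∣ a ∧ (r : ℤ) ∣ k) :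
    {P : Ideal O | P.IsPrime ∧ (r : O) ∈ P}.ncard = 1 := by
  obtain ⟨P, hP, hrP⟩ := h.exists_prime_mem hr
  have key : ∀ Q : Ideal O, Q.IsPrime → (r : O) ∈ Q → Q = Ideal.span {(r : O)} := by
    intro Q hQ hrQ
    refine le_antisymm (fun x hx => ?_) ((Ideal.span_singleton_le_iff_mem _).2 hrQ)
    obtain ⟨a, k, hak, -⟩ := h.exists_two_mul_eq hl hw hσ x
    have h1 : ((a ^ 2 - l * k ^ 2 : ℤ) : O) ∈ Q := by
      have : ((a ^ 2 - l * k ^ 2 : ℤ) : O) = 2 * x * (a - k * w) := by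
        rw [hak]; push_cast; rw [← hw]; ring
      rw [this, mul_comm (2 : O), mul_assoc]
      exact Q.mul_mem_right _ hx
    rw [h.intCast_mem_iff hr hrQ] at h1
    obtain ⟨⟨a', rfl⟩, ⟨k', rfl⟩⟩ := hrl a k h1
    obtain ⟨m, hm⟩ := hr.odd_of_ne_two hr2
    rw [Ideal.mem_span_singleton]
    refine ⟨x - m * (a' + k' * w), ?_⟩
    have h2 : (r : O) = 2 * m + 1 := by rw [hm]; push_cast; ring
    push_cast at hak
    linear_combination -(m : O) * hak - x * h2
  rw [Set.ncard_eq_one]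
  refine ⟨Ideal.span {(r : O)}, ?_⟩
  ext Q
  simp only [Set.mem_ofPred_eq, Set.mem_singleton_iff]
  constructor
  · rintro ⟨hQ, hrQ⟩
    exact key Q hQ hrQ
  · rintro rfl
    rw [← key P hP hrP]
    exact ⟨hP, hrP⟩

variable {θ : O} (hθ : 2 * θ = 1 + w)
include hθ

theorem half_sub_conj : θ - σ θ = w := by
  have h2 : (2 : O) ≠ 0 := by
    intro h0
    exact absurd (h.intCast_inj (a := 2) (b := 0).1 (by simpa using h0)) (by norm_num)
  apply mul_left_cancel₀ h2
  have h3 := congrArg σ hθ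
  simp only [map_mul, map_add, map_one, hσ, map_ofNat] at h3
  linear_combination hθ - h3

theorem eq_span_of_mem_ramifiedPrimes {P : Ideal O} (hP : P ∈ ramifiedPrimes ℤ O) :
    P = Ideal.span {w} := by
  obtain ⟨hPp, hP0, hPr⟩ := hP
  have h1 := h.sub_mem_of_ramified hP0 hPr θ
  rw [h.half_sub_conj hl hw hσ hθ] at h1
  exact h.eq_span_sqrt hl hw hσ (by rw [← hw]; exact P.pow_mem_of_mem h1 2 two_pos)

theorem natCast_notMem_sq {r : ℕ} (hr : r.Prime) (hrl : r ≠ l) {P : Ideal O} [hP : P.IsPrime]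
    (hrP : (r : O) ∈ P) : (r : O) ∉ P ^ 2 := by
  intro hmem
  have hP0 := h.ne_bot_of_prime_mem hr hrP
  have hle : Ideal.span {(r : O)} ≤ P ^ 2 := (Ideal.span_singleton_le_iff_mem _).2 hmem
  have hdec := h.decomposition hP0
  have hm := h.map_comap_eq_span hr hrP
  rcases hdec with h1 | h1 | h1
  · rw [← hm, h1] at hle
    exact not_le_sq hP0 hle
  · have h2 := h.eq_span_of_mem_ramifiedPrimes hl hw hσ hθ ⟨hP, hP0, h1.1⟩
    have h3 : ((l : ℤ) : O) ∈ P := by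
      rw [h2, Ideal.mem_span_singleton]
      exact ⟨w, by rw [← pow_two, hw]; simp⟩
    rw [h.intCast_mem_iff hr hrP, Int.natCast_dvd_natCast, Nat.prime_dvd_prime_iff_eq hr hl] at h3
    exact hrl h3
  · rw [← hm, h1.1, pow_two, mul_le_mul_left_iff hP0] at hle
    have := h.conj_prime (P := P)
    exact h1.2 ((this.isMaximal (h.conj_ne_bot hP0)).eq_of_le hP.ne_top hle)

theorem odd_card_classGroup [Fintype (ClassGroup O)] {ε : Oˣ} (hε : (ε : O) * σ ε = -1) :
    Odd (Fintype.card (ClassGroup O)) := by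
  by_contra hodd
  rw [Nat.not_odd_iff_even, even_iff_two_dvd] at hodd
  obtain ⟨c, hc⟩ := exists_prime_orderOf_dvd_card 2 hodd
  have hc2 : c ^ 2 = 1 := by rw [← hc, pow_orderOf_eq_one]
  have hc1 : c ≠ 1 := by rintro rfl; simp at hc
  apply hc1
  have hZ1 : Fintype.card (ClassGroup ℤ) = 1 := card_classGroup_eq_one
  obtain ⟨I, hI, rfl⟩ := h.exists_conj_eq_self (by rw [hZ1]; exact odd_one) (by
    intro u _
    rcases Int.units_eq_one_or u with rfl | rfl
    · exact ⟨1, by simp⟩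
    · exact ⟨ε, by simpa using hε⟩) c hc2
  obtain ⟨s, b, hs, hb⟩ := h.exists_eq_prod_mul_map I (nonZeroDivisors.coe_ne_zero I) hI
  rw [ClassGroup.mk0_eq_one_iff, hb]
  have h1 : ∏ P ∈ s, P = Ideal.span {w} ^ s.card := by
    rw [← Finset.prod_const]
    exact Finset.prod_congr rfl fun P hP => h.eq_span_of_mem_ramifiedPrimes hl hw hσ hθ (hs hP)
  obtain ⟨r, hr⟩ := (inferInstance : b.IsPrincipal)
  rw [h1, hr, Ideal.submodule_span_eq, Ideal.map_span, Set.image_singleton,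
    Ideal.span_singleton_pow, Ideal.span_singleton_mul_span_singleton]
  exact ⟨_, rfl⟩

end Quadratic

end IsQuadConj

namespace IsQuadConj

section Ramification

variable {O S : Type*} [CommRing O] [IsDedekindDomain O] [CommRing S] [IsDedekindDomain S]
  [Algebra O S] {τ : S ≃+* S}

theorem bijOn_comap_ramifiedPrimes (h : IsQuadConj O τ) (T : Set (Ideal O))
    (hT : ∀ p ∈ T, p.IsPrime ∧ p ≠ ⊥)
    (hdisc : ∀ P ∈ ramifiedPrimes O S, P.comap (algebraMap O S) ∈ T)
    (heis : ∀ p ∈ T, ∃ (x : S) (a b : O), x ^ 2 = algebraMap O S a * x + algebraMap O S b ∧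
      a ∈ p ∧ b ∈ p ∧ b ∉ p ^ 2) :
    Set.BijOn (Ideal.comap (algebraMap O S)) (ramifiedPrimes O S) T := by
  refine ⟨hdisc, ?_, ?_⟩
  · rintro P ⟨hP, hP0, hPr⟩ Q ⟨hQ, -, -⟩ hPQ
    rcases h.eq_or_eq_conj (Q := Q) hP0 hPQ.le with h1 | h1
    · exact h1.symm
    · rw [h1, h.conj_eq_of_ramified hP0 hPr]
  · intro p hp
    obtain ⟨hpp, hp0⟩ := hT p hp
    have := h.isIntegral
    obtain ⟨P, hP, hPp⟩ := Ideal.exists_ideal_over_prime_of_isIntegral_of_isDomain (S := S) p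
      (by rw [(RingHom.injective_iff_ker_eq_bot _).1 h.inj]; exact bot_le)
    have hP0 : P ≠ ⊥ := by
      rintro rfl
      apply hp0
      rw [← hPp, ← RingHom.ker_eq_comap_bot, (RingHom.injective_iff_ker_eq_bot _).1 h.inj]
    obtain ⟨x, a, b, hx, ha, hb, hb2⟩ := heis p hp
    rw [← hPp] at ha hb hb2
    exact ⟨P, ⟨hP, hP0, h.ramified_of_eisenstein hP0 hx ha hb hb2⟩, hPp⟩

variable {σ : O ≃+* O} (h : IsQuadConj ℤ σ)
include h

theorem ncard_primes_prod (R : Finset ℕ) (hR : ∀ r ∈ R, r.Prime)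
    (hfin : ∀ r ∈ R, {P : Ideal O | P.IsPrime ∧ (r : O) ∈ P}.Finite) :
    {P : Ideal O | P.IsPrime ∧ ∃ r ∈ R, (r : O) ∈ P}.Finite ∧
    {P : Ideal O | P.IsPrime ∧ ∃ r ∈ R, (r : O) ∈ P}.ncard =
      ∑ r ∈ R, {P : Ideal O | P.IsPrime ∧ (r : O) ∈ P}.ncard := by
  classical
  induction R using Finset.induction_on with
  | empty => simp
  | insert r R hr ih =>
    obtain ⟨h1, h2⟩ := ih (fun s hs => hR s (Finset.mem_insert_of_mem hs))
      (fun s hs => hfin s (Finset.mem_insert_of_mem hs))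
    have h3 := hfin r (Finset.mem_insert_self _ _)
    have hunion : {P : Ideal O | P.IsPrime ∧ ∃ s ∈ insert r R, (s : O) ∈ P} =
        {P : Ideal O | P.IsPrime ∧ (r : O) ∈ P} ∪
          {P : Ideal O | P.IsPrime ∧ ∃ s ∈ R, (s : O) ∈ P} := by
      ext P
      simp [and_or_left]
    rw [hunion, Finset.sum_insert hr, ← h2]
    refine ⟨h3.union h1, Set.ncard_union_eq ?_ h3 h1⟩
    rw [Set.disjoint_left]
    rintro P ⟨hP, hrP⟩ ⟨-, s, hs, hsP⟩
    have hrp := hR r (Finset.mem_insert_self _ _)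
    have hsp := hR s (Finset.mem_insert_of_mem hs)
    have h4 : ((s : ℤ) : O) ∈ P := by simpa
    rw [h.intCast_mem_iff hrp hrP, Int.natCast_dvd_natCast,
      Nat.prime_dvd_prime_iff_eq hrp hsp] at h4
    exact hr (h4 ▸ hs)

variable {l : ℕ} (hl : l.Prime) {w : O} (hw : w ^ 2 = l) (hσ : σ w = -w)
  {θ : O} (hθ : 2 * θ = 1 + w)
include hl hw hσ hθ

theorem ncard_ramifiedPrimes (hτ : IsQuadConj O τ) (ε : Oˣ) (n : ℕ) (hn : Squarefree n)
    (hnl : ¬ l ∣ n) {D : S} (hD : D ^ 2 = algebraMap O S (n * w * ε)) (hDτ : τ D = -D)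
    (hodd : Odd n → ∃ c : O, n * w * ε = 3 + 4 * c) (R : Finset ℕ)
    (hR : ∀ r : ℕ, r ∈ R ↔ r.Prime ∧ r ∣ 2 * n * l)
    (hfin : ∀ r ∈ R, {P : Ideal O | P.IsPrime ∧ (r : O) ∈ P}.Finite) :
    (ramifiedPrimes O S).Finite ∧
    (ramifiedPrimes O S).ncard = ∑ r ∈ R, {P : Ideal O | P.IsPrime ∧ (r : O) ∈ P}.ncard := by
  obtain ⟨h1, h2⟩ := h.ncard_primes_prod R (fun r hr => ((hR r).1 hr).1) hfin
  have hn0 : n ≠ 0 := hn.ne_zero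
  have hmem : ∀ (P : Ideal O), P.IsPrime → ∀ m : ℕ, m ≠ 0 → (m : O) ∈ P →
      ∃ r : ℕ, r.Prime ∧ r ∣ m ∧ (r : O) ∈ P := by
    intro P hP m
    induction m using Nat.recOnMul with
    | zero => intro h0; exact absurd rfl h0
    | one => intro _ h0; exact absurd ((P.eq_top_iff_one).2 (by simpa using h0)) hP.ne_top
    | prime r hr => intro _ h0; exact ⟨r, hr, dvd_rfl, h0⟩
    | mul a b iha ihb =>
      intro h0 hab
      push_cast at hab
      rcases hP.mem_or_mem hab with h3 | h3
      · obtain ⟨r, hr, hra, hrP⟩ := iha (left_ne_zero_of_mul h0) h3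
        exact ⟨r, hr, hra.mul_right _, hrP⟩
      · obtain ⟨r, hr, hra, hrP⟩ := ihb (right_ne_zero_of_mul h0) h3
        exact ⟨r, hr, hra.mul_left _, hrP⟩
  have hnot : ∀ (P : Ideal O), P.IsPrime → ∀ r : ℕ, r.Prime → (r : O) ∈ P → ∀ m : ℕ,
      (m : O) ∈ P → r ∣ m := by
    intro P hP r hr hrP m hm
    have : ((m : ℤ) : O) ∈ P := by simpa
    rwa [h.intCast_mem_iff hr hrP, Int.natCast_dvd_natCast] at this
  have hunit : ∀ P : Ideal O, P.IsPrime → (ε : O) ∉ P := fun P hP hε =>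
    hP.ne_top (P.eq_top_of_isUnit_mem hε ε.isUnit)
  have hbij := bijOn_comap_ramifiedPrimes hτ
    {P : Ideal O | P.IsPrime ∧ ∃ r ∈ R, (r : O) ∈ P} ?_ ?_ ?_
  · refine ⟨hbij.finite_iff_finite.2 h1, ?_⟩
    rw [← h2, ← hbij.image_eq, hbij.injOn.ncard_image]
  · rintro P ⟨hP, r, hr, hrP⟩
    exact ⟨hP, h.ne_bot_of_prime_mem ((hR r).1 hr).1 hrP⟩
  · rintro P ⟨hP, hP0, hPr⟩
    have hpp : (P.comap (algebraMap O S)).IsPrime := Ideal.comap_isPrime _ _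
    refine ⟨hpp, ?_⟩
    have h3 := hτ.sub_mem_of_ramified hP0 hPr D
    have h4 : (2 : O) * (2 * (n * w * ε)) ∈ P.comap (algebraMap O S) := by
      rw [Ideal.mem_comap]
      have : algebraMap O S (2 * (2 * (n * w * ε))) = (D - τ D) * (D - τ D) := by
        rw [hDτ, map_mul, map_mul, ← hD, map_ofNat]; ring
      rw [this]
      exact P.mul_mem_right _ h3
    obtain ⟨r, hr, hrd, hrP⟩ : ∃ r : ℕ, r.Prime ∧ r ∣ 2 * n * l ∧
        (r : O) ∈ P.comap (algebraMap O S) := by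
      apply hmem _ hpp _ (by simp [hn0, hl.ne_zero])
      push_cast
      rw [← hw]
      rcases hpp.mem_or_mem h4 with h5 | h5
      · rw [mul_assoc]; exact Ideal.mul_mem_right _ _ h5
      · rcases hpp.mem_or_mem h5 with h6 | h6
        · rw [mul_assoc]; exact Ideal.mul_mem_right _ _ h6
        · rcases hpp.mem_or_mem h6 with h7 | h7
          · have : (2 : O) * n * w ^ 2 = 2 * w * (n * w) := by ring
            rw [this]
            exact Ideal.mul_mem_left _ _ h7
          · exact absurd h7 (hunit _ hpp)
    exact ⟨r, (hR r).2 ⟨hr, hrd⟩, hrP⟩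
  · rintro p ⟨hp, r, hr, hrp⟩
    obtain ⟨hrp', hrd⟩ := (hR r).1 hr
    have hp0 := h.ne_bot_of_prime_mem hrp' hrp
    have eis : (n * w * ε : O) ∈ p → (n * w * ε : O) ∉ p ^ 2 → ∃ (x : S) (a b : O),
        x ^ 2 = algebraMap O S a * x + algebraMap O S b ∧ a ∈ p ∧ b ∈ p ∧ b ∉ p ^ 2 :=
      fun h3 h4 => ⟨D, 0, n * w * ε, by rw [hD]; simp, p.zero_mem, h3, h4⟩
    by_cases hrl : r = l
    · subst hrl
      have hpw := h.eq_span_sqrt hl hw hσ hrp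
      have hwp : w ∈ p := by rw [hpw]; exact Ideal.mem_span_singleton_self _
      refine eis (p.mul_mem_right _ (p.mul_mem_left _ hwp)) fun h3 => ?_
      rw [mul_right_comm] at h3
      rcases hp.mul_mem_pow _ h3 with h4 | h4
      · rcases hp.mem_or_mem h4 with h5 | h5
        · exact hnl (hnot p hp r hl hrp n h5)
        · exact hunit p hp h5
      · refine not_le_sq hp0 ?_
        nth_rw 1 [hpw]
        rwa [Ideal.span_singleton_le_iff_mem]
    · have hr2 := h.natCast_notMem_sq hl hw hσ hθ hrp' hrl hrp
      by_cases hrn : r ∣ n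
      · obtain ⟨m, rfl⟩ := hrn
        refine eis ?_ ?_
        · rw [mul_assoc]; push_cast; rw [mul_assoc]; exact p.mul_mem_right _ hrp
        · intro h3
          have h4 : ((m : O) * w * ε) * r ∈ p ^ 2 := by
            convert h3 using 1; push_cast; ring
          rcases hp.mul_mem_pow _ h4 with h5 | h5
          · rcases hp.mem_or_mem h5 with h6 | h6
            · rcases hp.mem_or_mem h6 with h7 | h7
              · obtain ⟨m', rfl⟩ := hnot p hp r hrp' hrp m h7
                exact hrp'.not_isUnit (hn r ⟨m', by ring⟩)
              · have h8 : (l : O) ∈ p := by rw [← hw]; exact p.pow_mem_of_mem h7 2 two_pos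
                exact hrl ((Nat.prime_dvd_prime_iff_eq hrp' hl).1 (hnot p hp r hrp' hrp l h8))
            · exact hunit p hp h6
          · exact hr2 h5
      · have hr_two : r = 2 := by
          rcases (Nat.Prime.dvd_mul hrp').1 hrd with h3 | h3
          · rcases (Nat.Prime.dvd_mul hrp').1 h3 with h4 | h4
            · exact (Nat.prime_dvd_prime_iff_eq hrp' Nat.prime_two).1 h4
            · exact absurd h4 hrn
          · exact absurd ((Nat.prime_dvd_prime_iff_eq hrp' hl).1 h3) hrl
        subst hr_two
        push_cast at hrp hr2
        obtain ⟨c, hc⟩ := hodd (Nat.not_even_iff_odd.1 fun he => hrn (even_iff_two_dvd.1 he))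
        refine ⟨1 + D, 2, n * w * ε - 1, ?_, hrp, ?_, ?_⟩
        · rw [map_sub, ← hD, map_ofNat, map_one]; ring
        · have : (n * w * ε - 1 : O) = 2 * (1 + 2 * c) := by rw [hc]; ring
          rw [this]
          exact p.mul_mem_right _ hrp
        · intro h3
          apply hr2
          have h4 : (2 : O) * 2 * c ∈ p ^ 2 := by
            rw [pow_two]; exact Ideal.mul_mem_right _ _ (Ideal.mul_mem_mul hrp hrp)
          have : (2 : O) = (n * w * ε - 1) - 2 * 2 * c := by rw [hc]; ring
          rw [this]
          exact (p ^ 2).sub_mem h3 h4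

end Ramification

end IsQuadConj

section TwoAdic

theorem PadicInt.two_dvd_of_toZModPow {x : ℤ_[2]} (hx : 4 * PadicInt.toZModPow 3 x = 0) :
    (2 : ℤ_[2]) ∣ x := by
  have h1 : PadicInt.toZModPow 3 (4 * x) = 0 := by
    rw [map_mul, map_ofNat]; exact hx
  rw [← RingHom.mem_ker, PadicInt.ker_toZModPow, Ideal.mem_span_singleton] at h1
  obtain ⟨c, hc⟩ := h1
  refine ⟨c, mul_left_cancel₀ (by norm_num : (4 : ℤ_[2]) ≠ 0) ?_⟩
  rw [hc]; push_cast; ring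

theorem PadicInt.eq_zero_of_forall_two_pow_dvd {z : ℤ_[2]} (h : ∀ k, (2 : ℤ_[2]) ^ k ∣ z) :
    z = 0 := by
  by_contra hz
  have h1 := h (z.valuation + 1)
  have h2 := (PadicInt.norm_le_pow_iff_mem_span_pow z (z.valuation + 1)).2
    (Ideal.mem_span_singleton.2 (by simpa using h1))
  rw [PadicInt.norm_le_pow_iff_le_valuation z hz] at h2
  omega

/-- A ternary form over the 2-adic integers which has only even zeros modulo `8` is anisotropic. -/
theorem PadicInt.eq_zero_of_zmod_eight {d e : ℤ_[2]}
    (hde : ∀ x y z : ZMod 8, x ^ 2 - PadicInt.toZModPow (p := 2) 3 d * y ^ 2 =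
      PadicInt.toZModPow (p := 2) 3 e * z ^ 2 → 4 * x = 0 ∧ 4 * y = 0 ∧ 4 * z = 0)
    {x y z : ℤ_[2]} (h : x ^ 2 - d * y ^ 2 = e * z ^ 2) : z = 0 := by
  apply PadicInt.eq_zero_of_forall_two_pow_dvd
  intro k
  induction k generalizing x y z with
  | zero => simp
  | succ k ih =>
    have h1 := congrArg (PadicInt.toZModPow (p := 2) 3) h
    simp only [map_sub, map_mul, map_pow] at h1
    obtain ⟨hx, hy, hz⟩ := hde _ _ _ h1
    obtain ⟨x', rfl⟩ := PadicInt.two_dvd_of_toZModPow hx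
    obtain ⟨y', rfl⟩ := PadicInt.two_dvd_of_toZModPow hy
    obtain ⟨z', rfl⟩ := PadicInt.two_dvd_of_toZModPow hz
    have h2 : x' ^ 2 - d * y' ^ 2 = e * z' ^ 2 :=
      mul_left_cancel₀ (by norm_num : (4 : ℤ_[2]) ≠ 0) (by linear_combination h)
    rw [pow_succ, mul_comm]
    exact mul_dvd_mul_left 2 (ih h2)

theorem PadicInt.exists_sq_eq_natCast {l : ℕ} (hl : l % 8 = 1) : ∃ s : ℤ_[2], s ^ 2 = l := by
  have h1 : ‖((Polynomial.X ^ 2 - Polynomial.C (l : ℤ_[2])).aeval (1 : ℤ_[2]))‖ <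
      ‖((Polynomial.X ^ 2 - Polynomial.C (l : ℤ_[2])).derivative.aeval (1 : ℤ_[2]))‖ ^ 2 := by
    have e1 : (Polynomial.X ^ 2 - Polynomial.C (l : ℤ_[2])).aeval (1 : ℤ_[2]) =
        ((1 - l : ℤ) : ℤ_[2]) := by simp
    have e2 : (Polynomial.X ^ 2 - Polynomial.C (l : ℤ_[2])).derivative.aeval (1 : ℤ_[2]) = 2 := by
      simp; norm_num
    have h2 : ‖(2 : ℤ_[2])‖ = 2⁻¹ := by simpa using PadicInt.norm_p (p := 2)
    have h3 : ‖((1 - l : ℤ) : ℤ_[2])‖ ≤ (2 : ℝ) ^ (-(3 : ℕ) : ℤ) := by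
      have := (PadicInt.norm_int_le_pow_iff_dvd (p := 2) (k := (1 - l : ℤ)) (n := 3)).2
        (by push_cast; omega)
      simpa using this
    rw [e1, e2, h2]
    refine h3.trans_lt ?_
    norm_num
  obtain ⟨s, hs, -⟩ := hensels_lemma h1
  refine ⟨s, ?_⟩
  simp at hs
  exact sub_eq_zero.1 hs

end TwoAdic

section NonNorm

/-- Reduction of the 2-adic integers modulo `8`. -/
noncomputable def PadicInt.toZModEight : ℤ_[2] →+* ZMod 8 := PadicInt.toZModPow 3

/-- The quadratic form `x² - d y² - e z²` has only even zeros modulo `8`. -/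
def AnisotropicModEight (d e : ZMod 8) : Prop :=
  ∀ x y z : ZMod 8, x ^ 2 - d * y ^ 2 = e * z ^ 2 → 4 * x = 0 ∧ 4 * y = 0 ∧ 4 * z = 0

theorem anisotropicModEight_of_odd {d e : ZMod 8} (hd : d = 3 ∨ d = 7) (he : e = 3 ∨ e = 7) :
    AnisotropicModEight d e := by
  unfold AnisotropicModEight
  rcases hd with rfl | rfl <;> rcases he with rfl | rfl <;> decide

theorem anisotropicModEight_of_even {d e : ZMod 8} (hd : d = 6) (he : e = 5 ∨ e = 7) :
    AnisotropicModEight d e := by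
  unfold AnisotropicModEight
  rcases hd with rfl; rcases he with rfl | rfl <;> decide

theorem anisotropicModEight_neg_one {n b a s : ZMod 8} (hn : n = 3 ∨ n = 7 ∨ n = 6)
    (hb : b = 1 ∨ b = 5) (hs : s ^ 2 = 1) : AnisotropicModEight (n * (b + 4 * a * s)) (-1) := by
  rcases hn with rfl | hn
  · exact anisotropicModEight_of_odd (by revert b a s; decide) (by decide)
  · rcases hn with rfl | rfl
    · exact anisotropicModEight_of_odd (by revert b a s; decide) (by decide)
    · exact anisotropicModEight_of_even (by revert b a s; decide) (by decide)

theorem anisotropicModEight_or {n b a s u : ZMod 8} (hn : n = 3 ∨ n = 7 ∨ n = 6)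
    (hb : b = 1 ∨ b = 5) (hs : s ^ 2 = 1) (hu : u = 1 ∨ u = -1) :
    AnisotropicModEight (n * (b + 4 * a * s)) (u * (4 * a + b * s)) ∨
      AnisotropicModEight (n * (b + 4 * a * -s)) (u * (4 * a + b * -s)) := by
  have h3 : (∀ b a s : ZMod 8, (b = 1 ∨ b = 5) → s ^ 2 = 1 → ∀ u : ZMod 8, (u = 1 ∨ u = -1) →
      ((3 * (b + 4 * a * s) = 3 ∨ 3 * (b + 4 * a * s) = 7) ∧
        (7 * (b + 4 * a * s) = 3 ∨ 7 * (b + 4 * a * s) = 7) ∧ 6 * (b + 4 * a * s) = 6) ∧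
      ((u * (4 * a + b * s) = 3 ∨ u * (4 * a + b * s) = 7) ∨
        (u * (4 * a + b * -s) = 3 ∨ u * (4 * a + b * -s) = 7)) ∧
      ((u * (4 * a + b * s) = 5 ∨ u * (4 * a + b * s) = 7) ∨
        (u * (4 * a + b * -s) = 5 ∨ u * (4 * a + b * -s) = 7))) := by decide
  obtain ⟨⟨h1, h2, h3'⟩, h4, h5⟩ := h3 b a s hb hs u hu
  obtain ⟨⟨h6, h7, h8⟩, -⟩ := h3 b a (-s) hb (by rw [neg_sq, hs]) u hu
  rcases hn with rfl | rfl | rfl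
  · exact h4.imp (anisotropicModEight_of_odd h1) (anisotropicModEight_of_odd h6)
  · exact h4.imp (anisotropicModEight_of_odd h2) (anisotropicModEight_of_odd h7)
  · exact h5.imp (anisotropicModEight_of_even h3') (anisotropicModEight_of_even h8)

end NonNorm

namespace IsQuadConj

section Norm

variable {O S : Type*} [CommRing O] [IsDomain O] [CommRing S] [IsDomain S] [Algebra O S]
  {τ : S ≃+* S}

theorem exists_ternary_zero (h : IsQuadConj O τ) (h2 : (2 : O) ≠ 0) {d : O} (hd : d ≠ 0) {D : S}
    (hD : D ^ 2 = algebraMap O S d) (hDτ : τ D = -D) {u : O} {x y : S} (hy : y ≠ 0)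
    (hxy : x * τ x = algebraMap O S u * (y * τ y)) :
    ∃ X Y Z : O, Z ≠ 0 ∧ X ^ 2 - d * Y ^ 2 = u * Z ^ 2 := by
  set z := x * τ y with hz
  have hτz : τ z = τ x * y := by rw [hz, map_mul, h.invol]
  obtain ⟨N, hN⟩ := h.exists_norm y
  obtain ⟨a, ha⟩ := h.exists_trace z
  obtain ⟨m, hm⟩ := (h.fix_iff ((z - τ z) * D)).1 (by
    rw [map_mul, map_sub, h.invol, hDτ]; ring)
  have hN0 : N ≠ 0 := by
    rintro rfl
    rw [map_zero, eq_comm, mul_eq_zero, EmbeddingLike.map_eq_zero_iff] at hN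
    tauto
  refine ⟨a * d, m, 2 * d * N, mul_ne_zero (mul_ne_zero h2 hd) hN0, h.inj ?_⟩
  simp only [map_sub, map_mul, map_pow, ha, hm, hN, map_ofNat]
  rw [hτz, hz, ← hD]
  have h3 : x * τ x * (y * τ y) = algebraMap O S u * (y * τ y) ^ 2 := by rw [hxy]; ring
  linear_combination (4 * D ^ 4) * h3

end Norm

section Quadratic

variable {O : Type*} [CommRing O] [IsDedekindDomain O] {σ : O ≃+* O} (h : IsQuadConj ℤ σ)
  {l : ℕ} (hl : l.Prime) {w : O} (hw : w ^ 2 = l) (hσ : σ w = -w)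
include h hl hw hσ

theorem eq_zero_of_anisotropic {s : ℤ_[2]} (hs : s ^ 2 = l) {a b a' b' : ℤ}
    (hde : AnisotropicModEight (PadicInt.toZModEight ((a : ℤ_[2]) + b * s))
      (PadicInt.toZModEight ((a' : ℤ_[2]) + b' * s))) {X Y Z : O}
    (hX : X ^ 2 - (a + b * w) * Y ^ 2 = (a' + b' * w) * Z ^ 2) : Z = 0 := by
  have hchar : CharZero O := ⟨fun m n hmn => by
    exact_mod_cast h.intCast_inj (a := m) (b := n).1 (by simpa using hmn)⟩
  have hsq : ∀ k : ℤ, (l : ℤ) ≠ k * k := fun k hk => by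
    have := (Nat.prime_iff_prime_int.1 hl).irreducible
    rw [hk] at this
    exact this.not_isSquare ⟨k, rfl⟩
  let f : ℤ√(l : ℤ) →+* O := Zsqrtd.lift ⟨w, by rw [← pow_two, hw]; simp⟩
  let g : ℤ√(l : ℤ) →+* ℤ_[2] := Zsqrtd.lift ⟨s, by rw [← pow_two, hs]; simp⟩
  have hf : Function.Injective f := Zsqrtd.lift_injective _ hsq
  have hg : Function.Injective g := Zsqrtd.lift_injective _ hsq
  have hfa : ∀ i j : ℤ, f ⟨i, j⟩ = i + j * w := fun i j => rfl
  have hga : ∀ i j : ℤ, g ⟨i, j⟩ = i + j * s := fun i j => rfl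
  obtain ⟨x, x', hx, -⟩ := h.exists_two_mul_eq hl hw hσ X
  obtain ⟨y, y', hy, -⟩ := h.exists_two_mul_eq hl hw hσ Y
  obtain ⟨z, z', hz, -⟩ := h.exists_two_mul_eq hl hw hσ Z
  rw [← hfa] at hx hy hz
  rw [← hfa, ← hfa] at hX
  rw [← hga, ← hga] at hde
  set d := (⟨a, b⟩ : ℤ√(l : ℤ))
  set e := (⟨a', b'⟩ : ℤ√(l : ℤ))
  have h1 : (⟨x, x'⟩ : ℤ√(l : ℤ)) ^ 2 - d * ⟨y, y'⟩ ^ 2 = e * ⟨z, z'⟩ ^ 2 := by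
    apply hf
    rw [map_sub, map_mul, map_mul, map_pow, map_pow, map_pow, ← hx, ← hy, ← hz]
    linear_combination 4 * hX
  have h2 := congrArg g h1
  rw [map_sub, map_mul, map_mul, map_pow, map_pow, map_pow] at h2
  have h3 := PadicInt.eq_zero_of_zmod_eight hde h2
  rw [hg (h3.trans (map_zero g).symm), map_zero] at hz
  simpa using hz

variable {S : Type*} [CommRing S] [IsDomain S] [Algebra O S] {τ : S ≃+* S}

theorem not_norm_of_anisotropic (hτ : IsQuadConj O τ) {n : ℕ} {A B : ℤ}
    {D : S} (hD : D ^ 2 = algebraMap O S (n * w * (A + B * w))) (hDτ : τ D = -D)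
    (hD0 : D ≠ 0) {a b : ℤ} {s : ℤ_[2]} (hs : s ^ 2 = l)
    (hde : AnisotropicModEight (n * (B * (l : ℕ) + A * PadicInt.toZModEight s))
      (a + b * PadicInt.toZModEight s)) {u v : Oˣ} (huv : (u : O) = (a + b * w) * v ^ 2)
    {x y : S} (hy : y ≠ 0) (hxy : x * τ x = algebraMap O S u * (y * τ y)) : False := by
  have h2 : (2 : O) ≠ 0 := by
    intro h0
    exact absurd (h.intCast_inj (a := 2) (b := 0).1 (by simpa using h0)) (by norm_num)
  obtain ⟨X, Y, Z, hZ, hXYZ⟩ := hτ.exists_ternary_zero h2 (d := n * w * (A + B * w)) (by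
    intro h0
    rw [h0, map_zero] at hD
    exact hD0 (pow_eq_zero_iff two_ne_zero |>.1 hD)) hD hDτ hy hxy
  have := h.eq_zero_of_anisotropic hl hw hσ hs (a := n * (B * l)) (b := n * A) (a' := a) (b' := b)
    (X := X) (Y := Y) (Z := v * Z) (by
      push_cast
      simp only [map_add, map_mul, map_natCast, map_intCast] at hde ⊢
      convert hde using 1
      ring) (by
      rw [huv] at hXYZ
      push_cast
      linear_combination hXYZ + n * B * Y ^ 2 * hw)
  simp [hZ] at this

theorem exists_eq_sq_of_norm (hl8 : l % 8 = 1) (hτ : IsQuadConj O τ) {n : ℕ}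
    (hn : n % 4 = 3 ∨ n % 8 = 6) {A B : ℤ}
    (hA : (4 : ℤ) ∣ A) (hB : B % 4 = 1) {ε : Oˣ} (hε : (ε : O) = A + B * w)
    (hunits : ∀ u : Oˣ, ∃ v, u = v ^ 2 ∨ u = -v ^ 2 ∨ u = ε * v ^ 2 ∨ u = -(ε * v ^ 2))
    {D : S} (hD : D ^ 2 = algebraMap O S (n * w * ε)) (hDτ : τ D = -D) (hD0 : D ≠ 0)
    (u : Oˣ) (hu : ∃ x y : S, y ≠ 0 ∧ x * τ x = algebraMap O S u * (y * τ y)) :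
    ∃ v, u = v ^ 2 := by
  obtain ⟨x, y, hy, hxy⟩ := hu
  obtain ⟨s, hs⟩ := PadicInt.exists_sq_eq_natCast hl8
  obtain ⟨a, rfl⟩ := hA
  rw [hε] at hD
  have hl1 : (l : ZMod 8) = 1 := by
    rw [← ZMod.natCast_mod, hl8]; simp
  have hs1 : (PadicInt.toZModEight s) ^ 2 = 1 := by
    rw [← map_pow, hs, map_natCast]; exact hl1
  have hn8 : (n : ZMod 8) = 3 ∨ (n : ZMod 8) = 7 ∨ (n : ZMod 8) = 6 := by
    have : n % 8 = 3 ∨ n % 8 = 7 ∨ n % 8 = 6 := by omega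
    rw [← ZMod.natCast_mod n 8]
    rcases this with h | h | h <;> rw [h] <;> simp
  have hB8 : (B : ZMod 8) = 1 ∨ (B : ZMod 8) = 5 := by
    have : B % 8 = 1 ∨ B % 8 = 5 := by omega
    have hBm : ((B % (8 : ℕ) : ℤ) : ZMod 8) = B := ZMod.intCast_mod B 8
    rw [← hBm]
    rcases this with h | h
    · left; push_cast; rw [h]; rfl
    · right; push_cast; rw [h]; rfl
  set t := PadicInt.toZModEight s with ht
  have key : ∀ s' : ℤ_[2], s' ^ 2 = l → ∀ a' b' : ℤ,
      AnisotropicModEight (n * (B + 4 * a * PadicInt.toZModEight s'))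
      (a' + b' * PadicInt.toZModEight s') → ∀ v : Oˣ, (u : O) = (a' + b' * w) * v ^ 2 →
      False := by
    intro s' hs' a' b' hde v huv
    refine h.not_norm_of_anisotropic hl hw hσ hτ hD hDτ hD0 hs' (a := a') (b := b') ?_ huv hy hxy
    convert hde using 2
    rw [hl1]; push_cast; ring
  obtain ⟨v, hv⟩ := hunits u
  have hv' := hv
  simp only [Units.ext_iff, Units.val_neg, Units.val_mul, Units.val_pow_eq_pow_val, hε] at hv'
  rcases hv' with hv' | hv' | hv' | hv'
  · exact ⟨v, Units.ext (by simpa using hv')⟩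
  · refine (key s hs (-1) 0 ?_ v (by rw [hv']; push_cast; ring)).elim
    convert anisotropicModEight_neg_one hn8 hB8 hs1 (a := a) using 1
    push_cast; ring
  · rcases anisotropicModEight_or (a := a) (u := 1) hn8 hB8 hs1 (by simp) with h1 | h1
    · refine (key s hs (4 * a) B ?_ v (by rw [hv'])).elim
      convert h1 using 1
      push_cast; ring
    · refine (key (-s) (by rw [neg_sq, hs]) (4 * a) B ?_ v (by rw [hv'])).elim
      rw [map_neg]
      convert h1 using 1
      push_cast; ring
  · rcases anisotropicModEight_or (a := a) (u := -1) hn8 hB8 hs1 (by simp) with h1 | h1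
    · refine (key s hs (-(4 * a)) (-B) ?_ v (by rw [hv']; push_cast; ring)).elim
      convert h1 using 1
      push_cast; ring
    · refine (key (-s) (by rw [neg_sq, hs]) (-(4 * a)) (-B) ?_ v
        (by rw [hv']; push_cast; ring)).elim
      rw [map_neg]
      convert h1 using 1
      push_cast; ring

end Quadratic

end IsQuadConj

theorem exists_eq_mul_sq_of_index_eq_four {G : Type*} [CommGroup G] {a b : G}
    (hG : (powMonoidHom 2 : G →* G).range.index = 4) (ha : ∀ v, a ≠ v ^ 2) (hb : ∀ v, b ≠ v ^ 2)
    (hab : ∀ v, b ≠ a * v ^ 2) (u : G) :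
    ∃ v, u = v ^ 2 ∨ u = a * v ^ 2 ∨ u = b * v ^ 2 ∨ u = a * b * v ^ 2 := by
  classical
  set H := (powMonoidHom 2 : G →* G).range with hH
  have hmem : ∀ x, x ∈ H ↔ ∃ v, v ^ 2 = x := fun x => Iff.rfl
  have hfin : Finite (G ⧸ H) := Nat.finite_of_card_ne_zero (by
    rw [← Subgroup.index_eq_card, hG]; norm_num)
  have := Fintype.ofFinite (G ⧸ H)
  have hq : ∀ x y : G, (QuotientGroup.mk x : G ⧸ H) = QuotientGroup.mk y ↔ ∃ v, y = x * v ^ 2 := by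
    intro x y
    rw [QuotientGroup.eq, hmem]
    refine exists_congr fun v => ?_
    rw [eq_inv_mul_iff_mul_eq, eq_comm]
  have huniv : ({(1 : G ⧸ H), QuotientGroup.mk a, QuotientGroup.mk b,
      QuotientGroup.mk (a * b)} : Finset (G ⧸ H)) = Finset.univ := by
    apply Finset.eq_univ_of_card
    rw [← Nat.card_eq_fintype_card, ← Subgroup.index_eq_card, hG,
      Finset.card_insert_of_notMem, Finset.card_insert_of_notMem, Finset.card_insert_of_notMem,
      Finset.card_singleton]
    · simp only [Finset.mem_singleton, hq, not_exists]
      intro v hv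
      exact ha v (mul_left_cancel (a := b) (by rw [mul_comm b a, hv]))
    · simp only [Finset.mem_insert, Finset.mem_singleton, hq, not_or, not_exists]
      exact ⟨hab, fun v hv => hb v (mul_left_cancel hv)⟩
    · simp only [Finset.mem_insert, Finset.mem_singleton, ← QuotientGroup.mk_one, hq, not_or,
        not_exists, one_mul]
      refine ⟨ha, hb, fun v hv => hab (a⁻¹ * v) ?_⟩
      rw [mul_pow, ← hv, pow_two]
      group
  have hu : (QuotientGroup.mk u : G ⧸ H) ∈ ({(1 : G ⧸ H), QuotientGroup.mk a, QuotientGroup.mk b,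
      QuotientGroup.mk (a * b)} : Finset (G ⧸ H)) := by rw [huniv]; exact Finset.mem_univ _
  simp only [Finset.mem_insert, Finset.mem_singleton, ← QuotientGroup.mk_one,
    eq_comm (a := QuotientGroup.mk u), hq] at hu
  rcases hu with ⟨v, hv⟩ | ⟨v, hv⟩ | ⟨v, hv⟩ | ⟨v, hv⟩
  · exact ⟨v, by simp [hv]⟩
  · exact ⟨v, by simp [hv]⟩
  · exact ⟨v, by simp [hv]⟩
  · exact ⟨v, by simp [hv]⟩

namespace IsQuadConj

section Count

variable {O : Type*} [CommRing O] [IsDedekindDomain O] {σ : O ≃+* O} (h : IsQuadConj ℤ σ)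
  {l : ℕ} (hl : l.Prime) {w : O} (hw : w ^ 2 = l) (hσ : σ w = -w)
include h hl hw hσ

theorem ncard_primes_of_not_isSquare (hl4 : l % 4 = 1) {r : ℕ} (hr : r.Prime) (hr2 : r ≠ 2)
    (hrl : ¬ IsSquare (r : ZMod l)) : {P : Ideal O | P.IsPrime ∧ (r : O) ∈ P}.ncard = 1 := by
  have := Fact.mk hl
  have := Fact.mk hr
  rw [ZMod.exists_sq_eq_prime_iff_of_mod_four_eq_one hl4 hr2] at hrl
  refine h.ncard_primes_of_inert hl hw hσ hr hr2 fun a k hak => ?_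
  rw [← ZMod.intCast_zmod_eq_zero_iff_dvd] at hak ⊢
  rw [← ZMod.intCast_zmod_eq_zero_iff_dvd]
  push_cast at hak
  have hk : (k : ZMod r) = 0 := by
    by_contra hk
    refine hrl ⟨a / k, ?_⟩
    field_simp
    linear_combination -hak
  rw [hk] at hak ⊢
  simpa using hak

theorem ncard_primes_of_isSquare (hl4 : l % 4 = 1) {r : ℕ} (hr : r.Prime) (hr2 : r ≠ 2)
    (hne : r ≠ l) (hrl : IsSquare (r : ZMod l)) :
    {P : Ideal O | P.IsPrime ∧ (r : O) ∈ P}.ncard = 2 := by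
  have := Fact.mk hl
  have := Fact.mk hr
  rw [ZMod.exists_sq_eq_prime_iff_of_mod_four_eq_one hl4 hr2] at hrl
  obtain ⟨s, hs⟩ := hrl
  obtain ⟨s, rfl⟩ := ZMod.intCast_surjective s
  have h1 : (r : ℤ) ∣ s ^ 2 - l := by
    rw [← ZMod.intCast_zmod_eq_zero_iff_dvd]
    push_cast
    rw [hs]; ring
  obtain ⟨a, ha⟩ := h1
  refine h.ncard_primes_of_split hr (x := s + w) (a := a) (b := 2 * s) ?_ ?_ ?_
  · have h2 := congrArg (Int.cast : ℤ → O) ha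
    push_cast at h2
    rw [map_add, map_intCast, hσ]
    linear_combination h2 - hw
  · rw [map_add, map_intCast, hσ]
    push_cast
    ring
  · intro h2
    rw [(Nat.prime_iff_prime_int.1 hr).dvd_mul] at h2
    rcases h2 with h2 | h2
    · exact hr2 ((Nat.prime_dvd_prime_iff_eq hr Nat.prime_two).1 (by exact_mod_cast h2))
    · have h3 : (r : ℤ) ∣ l := by
        have : (l : ℤ) = s * s - r * a := by rw [← ha]; ring
        rw [this]
        exact dvd_sub (h2.mul_left _) (dvd_mul_right _ _)
      exact hne ((Nat.prime_dvd_prime_iff_eq hr hl).1 (by exact_mod_cast h3))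

theorem ncard_primes_two (hl8 : l % 8 = 1) {θ : O} (hθ : 2 * θ = 1 + w) :
    {P : Ideal O | P.IsPrime ∧ (2 : O) ∈ P}.ncard = 2 := by
  have h1 := h.half_sub_conj hl hw hσ hθ
  have hσθ : σ θ = θ - w := by rw [← h1]; ring
  obtain ⟨m, hm⟩ : ∃ m, l = 8 * m + 1 := ⟨l / 8, by omega⟩
  have h4 : (4 : O) ≠ 0 := by
    intro h0
    exact absurd (h.intCast_inj (a := 4) (b := 0).1 (by simpa using h0)) (by norm_num)
  have := h.ncard_primes_of_split Nat.prime_two (x := θ) (a := -m) (b := 1) ?_ ?_ (by norm_num)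
  · simpa using this
  · apply mul_left_cancel₀ h4
    rw [hm] at hw
    rw [hσθ]
    push_cast at hw ⊢
    linear_combination -hw + (2 * θ + 1 - w) * hθ
  · rw [hσθ]
    push_cast
    linear_combination hθ

end Count

section Main

theorem _root_.Finset.squarefree_prod_primes {N : Finset ℕ} (hN : ∀ r ∈ N, r.Prime) :
    Squarefree (∏ r ∈ N, r) :=
  Finset.squarefree_prod_of_pairwise_isCoprime
    (fun r hr s hs hrs => (Nat.coprime_iff_isRelPrime.1
      ((Nat.coprime_primes (hN r hr) (hN s hs)).2 hrs))) fun r hr => (hN r hr).squarefree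

theorem _root_.Finset.prod_mod_four {N : Finset ℕ} (hN : ∀ r ∈ N, r % 4 = 3)
    (hodd : Odd N.card) : (∏ r ∈ N, r) % 4 = 3 := by
  have h1 : ((∏ r ∈ N, r : ℕ) : ZMod 4) = (3 : ℕ) := by
    push_cast
    rw [Finset.prod_congr rfl (g := fun _ => (-1 : ZMod 4)), Finset.prod_const, hodd.neg_one_pow]
    · rfl
    · intro r hr
      rw [← ZMod.natCast_mod, hN r hr]; rfl
  exact (ZMod.natCast_eq_natCast_iff' _ _ _).1 h1

variable {O S : Type*} [CommRing O] [IsDedekindDomain O] [CommRing S] [IsDedekindDomain S]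
  [Algebra O S] {σ : O ≃+* O} {τ : S ≃+* S}

theorem card_two_torsion_eq [Fintype (ClassGroup O)] (h : IsQuadConj ℤ σ) {l : ℕ} (hl : l.Prime)
    (hl8 : l % 8 = 1) {w θ : O} (hw : w ^ 2 = l) (hσ : σ w = -w) (hθ : 2 * θ = 1 + w)
    (hτ : IsQuadConj O τ) {A B : ℤ} (hA : 4 ∣ A) (hB : B % 4 = 1) {ε : Oˣ}
    (hε : (ε : O) = A + B * w) (hεnorm : A ^ 2 - l * B ^ 2 = -1)
    (hunits : ∀ u : Oˣ, ∃ v, u = v ^ 2 ∨ u = -v ^ 2 ∨ u = ε * v ^ 2 ∨ u = -(ε * v ^ 2))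
    (hneg : ∀ v : Oˣ, -1 ≠ v ^ 2) (hε' : ∀ v : Oˣ, ε ≠ v ^ 2 ∧ ε ≠ -v ^ 2)
    (hU : (powMonoidHom 2 : Sˣ →* Sˣ).range.index = 16)
    {P Q : Finset ℕ} (hPQ : Disjoint P Q) (hP : ∀ r ∈ P ∪ Q, r.Prime ∧ r % 4 = 3 ∧ r ≠ l)
    (hPl : ∀ r ∈ P, ¬ IsSquare (r : ZMod l)) (hQl : ∀ r ∈ Q, IsSquare (r : ZMod l))
    (hodd : Odd (P.card + Q.card)) {δ : ℕ} (hδ : δ = 1 ∨ δ = 2) {n : ℕ}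
    (hn : n = δ * ∏ r ∈ P ∪ Q, r)
    {D : S} (hD : D ^ 2 = algebraMap O S (n * w * ε)) (hDτ : τ D = -D) (hD0 : D ≠ 0) :
    Nat.card {c : ClassGroup S // c ^ 2 = 1} = 2 ^ (P.card + 2 * Q.card) := by
  classical
  have hm := Finset.prod_mod_four (fun r hr => (hP r hr).2.1)
    (by rwa [Finset.card_union_of_disjoint hPQ])
  have hsqf := Finset.squarefree_prod_primes (fun r hr => (hP r hr).1)
  set m := ∏ r ∈ P ∪ Q, r with hmdef
  have hdvd : ∀ r : ℕ, r.Prime → (r ∣ m ↔ r ∈ P ∪ Q) := by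
    intro r hr
    rw [hmdef, hr.prime.dvd_finsetProd_iff]
    constructor
    · rintro ⟨s, hs, hrs⟩
      rwa [(Nat.prime_dvd_prime_iff_eq hr (hP s hs).1).1 hrs]
    · exact fun h => ⟨r, h, dvd_rfl⟩
  have hl2 : l ≠ 2 := by rintro rfl; omega
  have hn2 : n % 4 = 3 ∨ n % 8 = 6 := by rcases hδ with rfl | rfl <;> omega
  have hnsq : Squarefree n := by
    rw [hn]
    rcases hδ with rfl | rfl
    · simpa using hsqf
    · exact Nat.squarefree_mul_iff.2 ⟨Nat.coprime_two_left.2 (Nat.odd_iff.2 (by omega)),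
        Nat.prime_two.squarefree, hsqf⟩
  have hlm : ¬ l ∣ m := fun h1 => (hP l ((hdvd l hl).1 h1)).2.2 rfl
  have hnl : ¬ l ∣ n := by
    rw [hn, hl.dvd_mul, not_or]
    refine ⟨fun h1 => ?_, hlm⟩
    have := Nat.le_of_dvd (by omega) h1
    have := hl.two_le
    omega
  have h2m : 2 ∉ P ∪ Q := fun h2 => by have := (hP 2 h2).2.1; omega
  have hlm' : l ∉ P ∪ Q := fun h2 => (hP l h2).2.2 rfl
  set R : Finset ℕ := insert 2 (insert l (P ∪ Q)) with hR
  have hRmem : ∀ r : ℕ, r ∈ R ↔ r.Prime ∧ r ∣ 2 * n * l := by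
    intro r
    rw [hR, Finset.mem_insert, Finset.mem_insert]
    constructor
    · rintro (rfl | rfl | hr)
      · exact ⟨Nat.prime_two, ⟨n * l, by ring⟩⟩
      · exact ⟨hl, dvd_mul_left _ _⟩
      · refine ⟨(hP r hr).1, Dvd.dvd.mul_right (Dvd.dvd.mul_left ?_ _) _⟩
        rw [hn]
        exact ((hdvd r (hP r hr).1).2 hr).mul_left δ
    · rintro ⟨hr, h1⟩
      rw [hr.dvd_mul, hr.dvd_mul, hn, hr.dvd_mul, hdvd r hr, Nat.prime_dvd_prime_iff_eq hr hl,
        Nat.prime_dvd_prime_iff_eq hr Nat.prime_two] at h1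
      rcases h1 with (h1 | h1 | h1) | h1
      · exact Or.inl h1
      · rcases hδ with rfl | rfl
        · exact absurd (Nat.dvd_one.1 h1) hr.one_lt.ne'
        · exact Or.inl ((Nat.prime_dvd_prime_iff_eq hr Nat.prime_two).1 h1)
      · exact Or.inr (Or.inr h1)
      · exact Or.inr (Or.inl h1)
  have hc2 := h.ncard_primes_two hl hw hσ hl8 hθ
  have hcl := h.ncard_primes_sqrt hl hw hσ
  have hcP : ∀ r ∈ P, {I : Ideal O | I.IsPrime ∧ (r : O) ∈ I}.ncard = 1 := by
    intro r hr
    obtain ⟨h1, h2, h3⟩ := hP r (Finset.mem_union_left _ hr)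
    exact h.ncard_primes_of_not_isSquare hl hw hσ (by omega) h1 (by rintro rfl; omega) (hPl r hr)
  have hcQ : ∀ r ∈ Q, {I : Ideal O | I.IsPrime ∧ (r : O) ∈ I}.ncard = 2 := by
    intro r hr
    obtain ⟨h1, h2, h3⟩ := hP r (Finset.mem_union_right _ hr)
    exact h.ncard_primes_of_isSquare hl hw hσ (by omega) h1 (by rintro rfl; omega) h3 (hQl r hr)
  have hfin : ∀ r ∈ R, {I : Ideal O | I.IsPrime ∧ (r : O) ∈ I}.Finite := by
    intro r hr
    apply Set.finite_of_ncard_ne_zero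
    rw [hR, Finset.mem_insert, Finset.mem_insert, Finset.mem_union] at hr
    rcases hr with rfl | rfl | hr | hr
    · push_cast; rw [hc2]; norm_num
    · rw [hcl]; norm_num
    · rw [hcP r hr]; norm_num
    · rw [hcQ r hr]; norm_num
  have hoddn : Odd n → ∃ c : O, n * w * ε = 3 + 4 * c := by
    intro hno
    obtain ⟨a, rfl⟩ := hA
    have h3 : (n * B * l) % 4 = 3 := by
      have e1 : (n : ℤ) % 4 = 3 := by rw [Nat.odd_iff] at hno; omega
      have e2 : (l : ℤ) % 4 = 1 := by omega
      simp [Int.mul_emod, e1, e2, hB]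
    obtain ⟨k, hk⟩ : ∃ k : ℤ, n * B * l = 3 + 4 * k := ⟨n * B * l / 4, by omega⟩
    have hk' := congrArg (Int.cast : ℤ → O) hk
    push_cast at hk'
    refine ⟨k + n * a * w, ?_⟩
    rw [hε]
    push_cast
    linear_combination hk' + n * B * hw
  obtain ⟨hf, hcard⟩ := h.ncard_ramifiedPrimes hl hw hσ hθ hτ ε n hnsq hnl hD hDτ hoddn R
    hRmem hfin
  have hsum : (ramifiedPrimes O S).ncard = P.card + 2 * Q.card + 3 := by
    rw [hcard, hR, Finset.sum_insert, Finset.sum_insert hlm', Finset.sum_union hPQ,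
      Finset.sum_congr rfl hcP, Finset.sum_congr rfl hcQ, hcl]
    · push_cast
      rw [hc2]
      simp
      ring
    · rw [Finset.mem_insert, not_or]
      exact ⟨hl2.symm, h2m⟩
  have hεσ : (ε : O) * σ ε = -1 := by
    rw [hε, map_add, map_mul, map_intCast, map_intCast, hσ]
    have := congrArg (Int.cast : ℤ → O) hεnorm
    push_cast at this
    linear_combination this - B ^ 2 * hw
  have hfinal := card_two_torsion (h.odd_card_classGroup hl hw hσ hθ hεσ) hτ
    (h.exists_eq_sq_of_norm hl hw hσ hl8 hτ hn2 hA hB hε hunits hD hDτ hD0) hneg hU ε hunits hε' hf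
  rw [hsum, pow_add] at hfinal
  exact Nat.eq_of_mul_eq_mul_right (by norm_num : 0 < 8) hfinal

end Main

end IsQuadConj

theorem Algebra.IsQuadraticExtension.exists_conj {k L : Type*} [Field k] [Field L] [CharZero k]
    [Algebra k L] [Algebra.IsQuadraticExtension k L] {α : L} {a : k} (hα : α ^ 2 = algebraMap k L a)
    (hαk : ∀ b, algebraMap k L b ≠ α) :
    ∃ σ : Gal(L/k), (∀ x, σ (σ x) = x) ∧ (∀ x, σ x = x → ∃ r, algebraMap k L r = x) ∧ σ α = -α := by
  have hcard : Nat.card Gal(L/k) = 2 := by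
    rw [IsGalois.card_aut_eq_finrank, Algebra.IsQuadraticExtension.finrank_eq_two]
  obtain ⟨σ, hσ, hu⟩ := (Nat.card_eq_two_iff' (1 : Gal(L/k))).1 hcard
  have hfix : ∀ x, σ x = x → ∃ r, algebraMap k L r = x := by
    intro x hx
    have := (IsGalois.mem_bot_iff_fixed (F := k) x).2 fun f => by
      by_cases hf : f = 1
      · simp [hf]
      · rw [hu f hf, hx]
    exact IntermediateField.mem_bot.1 this
  refine ⟨σ, fun x => ?_, hfix, ?_⟩
  · have h1 : σ ^ 2 = 1 := by rw [← hcard, pow_card_eq_one']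
    have := DFunLike.congr_fun h1 x
    simpa [pow_two] using this
  · have h1 : (σ α - α) * (σ α + α) = 0 := by
      have h2 : σ α ^ 2 = α ^ 2 := by rw [← map_pow, hα, AlgEquiv.commutes]
      linear_combination h2
    rcases mul_eq_zero.1 h1 with h2 | h2
    · obtain ⟨r, hr⟩ := hfix α (sub_eq_zero.1 h2)
      exact absurd hr (hαk r)
    · exact eq_neg_of_add_eq_zero_left h2

theorem IsQuadConj.exists_ringOfIntegers (R k L : Type*) [CommRing R] [IsDomain R]
    [IsIntegrallyClosed R] [Field k] [Algebra R k] [IsFractionRing R k] [Field L] [CharZero k]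
    [Algebra k L] [Algebra R (𝓞 L)] [Algebra R L] [IsScalarTower R k L] [IsScalarTower R (𝓞 L) L]
    [Algebra.IsQuadraticExtension k L] {α : 𝓞 L} {a : k}
    (hα : (α : L) ^ 2 = algebraMap k L a) (hαk : ∀ b, algebraMap k L b ≠ α) :
    ∃ σ : 𝓞 L ≃+* 𝓞 L, IsQuadConj R σ ∧ σ α = -α := by
  obtain ⟨f, hf1, hf2, hf3⟩ := Algebra.IsQuadraticExtension.exists_conj hα hαk
  let σ : 𝓞 L ≃+* 𝓞 L := RingOfIntegers.mapRingEquiv f.toRingEquiv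
  have hσ : ∀ x, (σ x : L) = f x := fun x => rfl
  have hRL : ∀ r : R, ((algebraMap R (𝓞 L) r : 𝓞 L) : L) = algebraMap k L (algebraMap R k r) :=
    fun r => by
      rw [RingOfIntegers.coe_eq_algebraMap, ← IsScalarTower.algebraMap_apply,
        ← IsScalarTower.algebraMap_apply]
  refine ⟨σ, ⟨?_, ?_, ?_, α, ?_, ?_⟩, ?_⟩
  · intro x y hxy
    have := congrArg (fun z : 𝓞 L => (z : L)) hxy
    simp only [hRL] at this
    exact IsFractionRing.injective R k ((algebraMap k L).injective this)
  · intro x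
    exact RingOfIntegers.ext (hf1 x)
  · intro x
    constructor
    · intro hx
      obtain ⟨r, hr⟩ := hf2 x (by rw [← hσ, hx])
      have hint : IsIntegral R r := by
        have h1 : IsIntegral R (algebraMap k L r) := by
          rw [hr]
          exact (RingOfIntegers.isIntegral_coe x).tower_top
        exact (isIntegral_algebraMap_iff (algebraMap k L).injective).1 h1
      obtain ⟨s, hs⟩ := IsIntegrallyClosed.isIntegral_iff.1 hint
      exact ⟨s, RingOfIntegers.ext (by rw [hRL, hs, hr])⟩
    · rintro ⟨r, rfl⟩
      exact RingOfIntegers.ext (by rw [hσ, hRL, AlgEquiv.commutes])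
  · rintro rfl
    exact hαk 0 (by simp)
  · exact RingOfIntegers.ext (by rw [hσ, hf3]; simp)
  · exact RingOfIntegers.ext (by rw [hσ, hf3]; simp)

theorem isIntegral_of_sq_eq_add_intCast {R : Type*} [CommRing R] {x : R} {m : ℤ}
    (hx : x ^ 2 = x + m) : IsIntegral ℤ x := by
  refine ⟨Polynomial.X ^ 2 - Polynomial.X - Polynomial.C m, ?_, ?_⟩
  · monicity!
  · rw [Polynomial.eval₂_sub, Polynomial.eval₂_sub, Polynomial.eval₂_pow, Polynomial.eval₂_X,
      Polynomial.eval₂_C, hx]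
    simp

theorem Nat.Prime.rat_sq_ne {l : ℕ} (hl : l.Prime) (b : ℚ) : b ^ 2 ≠ l := by
  intro h
  have h3 : IsSquare (l : ℚ) := ⟨b, by rw [← h, pow_two]⟩
  rw [Rat.isSquare_natCast_iff] at h3
  exact hl.prime.irreducible.not_isSquare h3

theorem Nat.Prime.algebraMap_rat_ne {F : Type*} [Field F] [Algebra ℚ F] {l : ℕ} (hl : l.Prime)
    {w : F} (hw : w ^ 2 = l) (b : ℚ) : algebraMap ℚ F b ≠ w := by
  rintro rfl
  refine hl.rat_sq_ne b ((algebraMap ℚ F).injective ?_)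
  rw [map_pow, hw, map_natCast]

theorem sq_ne_natCast_mul_of_norm_eq_neg_one {F : Type*} [Field F] [Algebra ℚ F]
    [Algebra.IsQuadraticExtension ℚ F] {l : ℕ} (hl : l.Prime) {w : F} (hw : w ^ 2 = l) {A B : ℤ}
    (hε : A ^ 2 - l * B ^ 2 = -1) {n : ℕ} (hn : n ≠ 0) (b : F) : b ^ 2 ≠ n * w * (A + B * w) := by
  intro h
  obtain ⟨σ, hσ, hfix, hσw⟩ := Algebra.IsQuadraticExtension.exists_conj (k := ℚ) (α := w) (a := l)
    (by rw [hw, map_natCast]) (hl.algebraMap_rat_ne hw)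
  obtain ⟨r, hr⟩ := hfix (b * σ b) (by rw [map_mul, hσ, mul_comm])
  have h1 := congrArg σ h
  simp only [map_pow, map_mul, map_add, map_natCast, map_intCast, hσw] at h1
  have hε' : (A : F) ^ 2 - l * B ^ 2 = -1 := by exact_mod_cast congrArg (Int.cast : ℤ → F) hε
  have h2 : r ^ 2 = n ^ 2 * l := by
    apply (algebraMap ℚ F).injective
    rw [map_pow, hr, mul_pow, h, h1]
    simp only [map_mul, map_pow, map_natCast]
    linear_combination (-(n : F) ^ 2 * (A ^ 2 - B ^ 2 * w ^ 2 - l * B ^ 2)) * hw - n ^ 2 * l * hε'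
  have hn' : (n : ℚ) ≠ 0 := by exact_mod_cast hn
  refine hl.rat_sq_ne (r / n) ?_
  rw [div_pow, h2]
  field_simp

namespace NumberField

variable {F K : Type*} [Field F] [Field K] [NumberField F] [NumberField K] [Algebra F K]
  [IsTotallyReal K] [Algebra.IsQuadraticExtension ℚ F] [Algebra.IsQuadraticExtension F K]

theorem card_two_torsion_classGroup {l : ℕ} (hl : l.Prime)
    (hl8 : l % 8 = 1) {w : F} (hw : w ^ 2 = l) {A B : ℤ} (hA : 4 ∣ A) (hB : B % 4 = 1)
    (hεnorm : A ^ 2 - l * B ^ 2 = -1)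
    {P Q : Finset ℕ} (hPQ : Disjoint P Q) (hP : ∀ r ∈ P ∪ Q, r.Prime ∧ r % 4 = 3 ∧ r ≠ l)
    (hPl : ∀ r ∈ P, ¬ IsSquare (r : ZMod l)) (hQl : ∀ r ∈ Q, IsSquare (r : ZMod l))
    (hodd : Odd (P.card + Q.card)) {δ : ℕ} (hδ : δ = 1 ∨ δ = 2) {n : ℕ}
    (hn : n = δ * ∏ r ∈ P ∪ Q, r) {D : K} (hD : D ^ 2 = algebraMap F K (n * w * (A + B * w))) :
    Nat.card {c : ClassGroup (𝓞 K) // c ^ 2 = 1} = 2 ^ (P.card + 2 * Q.card) := by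
  have hn0 : (n : ℤ) ≠ 0 := by
    rw [hn]
    push_cast
    refine mul_ne_zero (by rcases hδ with rfl | rfl <;> norm_num) ?_
    rw [Finset.prod_ne_zero_iff]
    exact fun r hr => by exact_mod_cast (hP r hr).1.ne_zero
  have hTF : IsTotallyReal F := IsTotallyReal.of_algebra F K
  have hint : ∀ m : ℤ, IsIntegral ℤ (m : F) := fun m => by
    simpa using isIntegral_algebraMap (R := ℤ) (A := F) (x := m)
  have hwint : IsIntegral ℤ w := IsIntegral.of_pow two_pos (by
    rw [hw]; simpa using hint l)
  obtain ⟨k, hk⟩ : ∃ k : ℤ, (l : ℤ) = 1 + 4 * k := ⟨l / 4, by omega⟩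
  have hθint : IsIntegral ℤ ((1 + w) / 2) := by
    apply isIntegral_of_sq_eq_add_intCast (m := k)
    have hk' : (l : F) = 1 + 4 * k := by exact_mod_cast congrArg (Int.cast : ℤ → F) hk
    linear_combination (1 / 4) * hw + (1 / 4) * hk'
  have hDint : IsIntegral ℤ D := IsIntegral.of_pow two_pos (by
    rw [hD]
    have h1 : IsIntegral ℤ (n * w * (A + B * w)) :=
      ((by simpa using hint n : IsIntegral ℤ (n : F)).mul hwint).mul
        ((hint A).add ((hint B).mul hwint))
    exact h1.map (IsScalarTower.toAlgHom ℤ F K))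
  let W : 𝓞 F := ⟨w, hwint⟩
  let θ : 𝓞 F := ⟨(1 + w) / 2, hθint⟩
  let D' : 𝓞 K := ⟨D, hDint⟩
  have hW : W ^ 2 = l := RingOfIntegers.ext hw
  have hθ : 2 * θ = 1 + W := RingOfIntegers.ext (by
    change 2 * ((1 + w) / 2) = 1 + w
    ring)
  obtain ⟨σ, hσ, hσW⟩ := IsQuadConj.exists_ringOfIntegers ℤ ℚ F (α := W) (a := l)
    (by rw [map_natCast]; exact hw) (hl.algebraMap_rat_ne hw)
  have hnorm : (A : 𝓞 F) ^ 2 - l * B ^ 2 = -1 := by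
    exact_mod_cast congrArg (Int.cast : ℤ → 𝓞 F) hεnorm
  let ε : (𝓞 F)ˣ := ⟨A + B * W, -(A - B * W), by linear_combination B ^ 2 * hW - hnorm,
    by linear_combination B ^ 2 * hW - hnorm⟩
  have hε : (ε : 𝓞 F) = A + B * W := rfl
  have hεσ : (ε : 𝓞 F) * σ ε = -1 := by
    rw [hε, map_add, map_mul, map_intCast, map_intCast, hσW]
    linear_combination hnorm - B ^ 2 * hW
  have hD' : D' ^ 2 = algebraMap (𝓞 F) (𝓞 K) (n * W * ε) := RingOfIntegers.ext hD
  obtain ⟨τ, hτ, hτD⟩ := IsQuadConj.exists_ringOfIntegers (𝓞 F) F K (α := D') hD (by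
    intro b hb
    refine sq_ne_natCast_mul_of_norm_eq_neg_one hl hw hεnorm (n := n) (by exact_mod_cast hn0) b
      ((algebraMap F K).injective ?_)
    rw [map_pow, hb]
    exact hD)
  have hD0 : D' ≠ 0 := by
    intro h0
    obtain ⟨x, hx0, hx⟩ := hτ.nontriv
    rw [h0] at hD'
    have h1 : (n * W * ε : 𝓞 F) = 0 := hτ.inj (by rw [← hD', map_zero]; ring)
    rw [mul_eq_zero, mul_eq_zero] at h1
    rcases h1 with (h1 | h1) | h1
    · exact hn0 (by exact_mod_cast h1)
    · exact hσ.sqrt_ne_zero hl hW hσW h1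
    · exact ε.ne_zero h1
  obtain ⟨φ⟩ : Nonempty (F →+* ℂ) := inferInstance
  let ψ : 𝓞 F →+* ℝ := (IsTotallyReal.complexEmbedding_isReal φ).embedding.comp (algebraMap (𝓞 F) F)
  have hneg1 : ∀ x : 𝓞 F, -1 ≠ x ^ 2 := by
    intro x hx
    have h1 := congrArg ψ hx
    rw [map_neg, map_one, map_pow] at h1
    nlinarith [sq_nonneg (ψ x)]
  have hneg : ∀ v : (𝓞 F)ˣ, -1 ≠ v ^ 2 := fun v hv =>
    hneg1 v (by simpa using congrArg (Units.val) hv)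
  have hε' : ∀ v : (𝓞 F)ˣ, ε ≠ v ^ 2 ∧ ε ≠ -v ^ 2 := by
    refine fun v => ⟨fun hv => hneg1 (v * σ v) ?_, fun hv => hneg1 (v * σ v) ?_⟩
    · rw [← hεσ, hv, Units.val_pow_eq_pow_val, map_pow]
      ring
    · rw [← hεσ, hv, Units.val_neg, Units.val_pow_eq_pow_val, map_neg, map_pow]
      ring
  have hUF : (powMonoidHom 2 : (𝓞 F)ˣ →* (𝓞 F)ˣ).range.index = 4 := by
    rw [Units.index_range_powMonoidHom_two, Units.rank_of_isTotallyReal,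
      Algebra.IsQuadraticExtension.finrank_eq_two]
    norm_num
  have hUK : (powMonoidHom 2 : (𝓞 K)ˣ →* (𝓞 K)ˣ).range.index = 16 := by
    rw [Units.index_range_powMonoidHom_two, Units.rank_of_isTotallyReal,
      ← Module.finrank_mul_finrank ℚ F K, Algebra.IsQuadraticExtension.finrank_eq_two,
      Algebra.IsQuadraticExtension.finrank_eq_two]
    norm_num
  have hunits := exists_eq_mul_sq_of_index_eq_four hUF hneg (fun v => (hε' v).1)
    (fun v hv => (hε' v).2 (by rw [hv, neg_one_mul]))
  exact IsQuadConj.card_two_torsion_eq hσ hl hl8 hW hσW hθ hτ hA hB hε hεnorm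
    (fun u => (hunits u).imp fun v hv => by simpa using hv) hneg hε' hUK hPQ hP hPl hQl hodd hδ hn
    hD' hτD hD0

end NumberField

theorem Rat.exists_eq_intCast_of_isIntegral {x : ℚ} (hx : IsIntegral ℤ (x : ℝ)) :
    ∃ a : ℤ, x = a := by
  have h1 : IsIntegral ℤ x := by
    rw [← isIntegral_algebraMap_iff (algebraMap ℚ ℝ).injective]
    exact hx
  obtain ⟨a, ha⟩ := IsIntegrallyClosed.isIntegral_iff.1 h1
  exact ⟨a, by rw [← ha]; simp⟩

theorem even_of_sq_sub_mul_sq {l : ℕ} (hl8 : l % 8 = 1) {a b : ℤ}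
    (h : a ^ 2 - l * b ^ 2 = -4) : Even a ∧ Even b := by
  obtain ⟨k, hk⟩ : ∃ k : ℤ, (l : ℤ) = 8 * k + 1 := ⟨l / 8, by omega⟩
  rw [hk] at h
  rcases Int.even_or_odd' a with ⟨c, rfl | rfl⟩ <;> rcases Int.even_or_odd' b with ⟨d, rfl | rfl⟩
  · exact ⟨by simp, by simp⟩
  · ring_nf at h; omega
  · ring_nf at h; omega
  · exfalso
    obtain ⟨x, hx⟩ := Int.even_mul_succ_self c
    obtain ⟨y, hy⟩ := Int.even_mul_succ_self d
    have : 8 * x - 8 * y - 8 * (k * (2 * d + 1) ^ 2) = -4 := by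
      linear_combination h - 4 * hx + 4 * hy
    omega

theorem four_dvd_and_mod_four_of_sq_sub_mul_sq {l : ℕ} (hl8 : l % 8 = 1) {A B : ℤ}
    (h : A ^ 2 - l * B ^ 2 = -1) (hB : 0 < B) : 4 ∣ A ∧ B % 4 = 1 := by
  obtain ⟨k, hk⟩ : ∃ k : ℤ, (l : ℤ) = 8 * k + 1 := ⟨l / 8, by omega⟩
  have hodd : Odd B ∧ 4 ∣ A := by
    rw [hk] at h
    rcases Int.even_or_odd' A with ⟨c, rfl | rfl⟩ <;>
      rcases Int.even_or_odd' B with ⟨d, rfl | rfl⟩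
    · exfalso; ring_nf at h; omega
    · refine ⟨by simp, ?_⟩
      obtain ⟨y, hy⟩ := Int.even_mul_succ_self d
      rcases Int.even_or_odd' c with ⟨e, rfl | rfl⟩
      · exact ⟨e, by ring⟩
      · exfalso
        obtain ⟨x, hx⟩ := Int.even_mul_succ_self e
        have : 4 * (8 * x + 1) - 8 * y - 8 * (k * (2 * d + 1) ^ 2) = 0 := by
          linear_combination h - 16 * hx + 4 * hy
        omega
    · exfalso
      obtain ⟨x, hx⟩ := Int.even_mul_succ_self c
      have : 8 * x + 2 - 4 * ((8 * k + 1) * d ^ 2) = 0 := by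
        linear_combination h - 4 * hx
      omega
    · exfalso; ring_nf at h; omega
  refine ⟨hodd.2, ?_⟩
  obtain ⟨b, rfl⟩ := Int.eq_ofNat_of_zero_le hB.le
  have hcop : A.gcd b = 1 := by
    rw [← Int.isCoprime_iff_gcd_eq_one]
    exact ⟨-A, l * b, by linear_combination -h⟩
  have hb : Odd b := by exact_mod_cast hodd.1
  have h1 : jacobiSym (-1) b = 1 := by
    refine Eq.trans ?_ (jacobiSym.sq_one' hcop)
    exact jacobiSym.mod_left' (Int.modEq_iff_dvd.2 ⟨l * b, by linear_combination h⟩)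
  rw [jacobiSym.at_neg_one hb] at h1
  have h3 : b % 4 ≠ 3 := fun h3 => by
    rw [ZMod.χ₄_nat_three_mod_four h3] at h1
    norm_num at h1
  rw [Nat.odd_iff] at hb
  omega

theorem exists_int_of_isIntegral_of_norm_eq_neg_one {l : ℕ} (hl : l.Prime) (hl8 : l % 8 = 1)
    {u v : ℚ} (hint : IsIntegral ℤ (u + v * √(l : ℝ))) (hinv : IsIntegral ℤ (u + v * √(l : ℝ))⁻¹)
    (hnorm : u ^ 2 - v ^ 2 * l = -1) : ∃ A B : ℤ, u = A ∧ v = B := by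
  have hs : √(l : ℝ) ^ 2 = l := Real.sq_sqrt (Nat.cast_nonneg l)
  have hnorm' : (u : ℝ) ^ 2 - v ^ 2 * l = -1 := by exact_mod_cast hnorm
  have hinv' : (u + v * √(l : ℝ))⁻¹ = -(u - v * √(l : ℝ)) := by
    apply inv_eq_of_mul_eq_one_right
    linear_combination (v : ℝ) ^ 2 * hs - hnorm'
  rw [hinv'] at hinv
  obtain ⟨a, ha⟩ := Rat.exists_eq_intCast_of_isIntegral (x := 2 * u) (by
    have := hint.sub hinv
    rwa [show u + v * √(l : ℝ) - -(u - v * √(l : ℝ)) = (2 * u : ℚ) by push_cast; ring] at this)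
  have hl0 : (l : ℚ) ≠ 0 := by exact_mod_cast hl.ne_zero
  have h2 : (l * (2 * v)) ^ 2 = ((l * (a ^ 2 + 4) : ℤ) : ℚ) := by
    push_cast
    rw [← ha]
    linear_combination -4 * l * hnorm
  obtain ⟨c, hc⟩ : ∃ c : ℤ, l * (2 * v) = c := by
    apply Rat.exists_eq_intCast_of_isIntegral
    apply IsIntegral.of_pow two_pos
    rw [← Rat.cast_pow, h2, Rat.cast_intCast]
    exact isIntegral_algebraMap (R := ℤ) (A := ℝ)
  rw [hc] at h2
  have h3 : c ^ 2 = l * (a ^ 2 + 4) := by exact_mod_cast h2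
  obtain ⟨b, rfl⟩ : (l : ℤ) ∣ c :=
    (Nat.prime_iff_prime_int.1 hl).dvd_of_dvd_pow ⟨_, h3⟩
  have hb : 2 * v = b := by
    push_cast at hc
    exact mul_left_cancel₀ hl0 hc
  have h4 : a ^ 2 - l * b ^ 2 = -4 := by
    have : (a : ℚ) ^ 2 - l * b ^ 2 = -4 := by
      rw [← ha, ← hb]
      linear_combination 4 * hnorm
    exact_mod_cast this
  obtain ⟨⟨A, rfl⟩, B, rfl⟩ := even_of_sq_sub_mul_sq hl8 h4
  push_cast at ha hb
  exact ⟨A, B, by linarith, by linarith⟩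

open IntermediateField in
theorem IntermediateField.finrank_adjoin_simple_eq_two {k L : Type*} [Field k] [Field L]
    [Algebra k L] {α : L} {a : k} (hα : α ^ 2 = algebraMap k L a) (ha : ∀ b, b ^ 2 ≠ a) :
    Module.finrank k k⟮α⟯ = 2 := by
  have h1 : minpoly k α = Polynomial.X ^ 2 - Polynomial.C a :=
    (minpoly.eq_of_irreducible_of_monic (X_pow_sub_C_irreducible_of_prime Nat.prime_two ha)
      (by simp [hα]) (Polynomial.monic_X_pow_sub_C a two_ne_zero)).symm
  rw [adjoin.finrank, h1, Polynomial.natDegree_X_pow_sub_C]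
  exact minpoly.ne_zero_iff.1 (by rw [h1]; exact Polynomial.X_pow_sub_C_ne_zero two_pos a)

theorem Complex.star_eq_self_of_sq_eq_ofReal {z : ℂ} {r : ℝ} (hr : 0 ≤ r) (hz : z ^ 2 = r) :
    star z = z := by
  have h1 : z ^ 2 = ((√r : ℝ) : ℂ) ^ 2 := by
    rw [hz, ← Complex.ofReal_pow, Real.sq_sqrt hr]
  rcases sq_eq_sq_iff_eq_or_eq_neg.1 h1 with rfl | rfl <;> simp

namespace NumberField

open IntermediateField

theorem isTotallyReal_of_adjoin_eq_top {K : Type*} [Field K] [NumberField K] {D : K}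
    (hD : ℚ⟮D⟯ = ⊤) (h : ∀ φ : K →+* ℂ, star (φ D) = φ D) : IsTotallyReal K := by
  rw [← maximalRealSubfield_eq_top_iff_isTotallyReal, eq_top_iff]
  intro x _
  have hx : x ∈ ℚ⟮D⟯ := by rw [hD]; trivial
  have h1 : ℚ⟮D⟯ ≤ (maximalRealSubfield K).toIntermediateField fun r => by
      rw [eq_ratCast]; exact SubfieldClass.ratCast_mem _ r :=
    adjoin_simple_le_iff.2 ((mem_maximalRealSubfield_iff D).2 h)
  exact h1 hx

theorem star_eq_self_of_sq_eq {K : Type*} [Field K] {l : ℕ} {w : K} (hw : w ^ 2 = l) {A B : ℤ}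
    (hε : A ^ 2 - l * B ^ 2 = -1) (hB : 0 < B) {n : ℕ} {D : K}
    (hD : D ^ 2 = n * w * (A + B * w)) (φ : K →+* ℂ) : star (φ D) = φ D := by
  have hs : √(l : ℝ) ^ 2 = l := Real.sq_sqrt (Nat.cast_nonneg l)
  obtain ⟨s, hs2, hsw⟩ : ∃ s : ℝ, s ^ 2 = l ∧ φ w = s := by
    have h1 : φ w ^ 2 = ((√(l : ℝ) : ℝ) : ℂ) ^ 2 := by
      rw [← map_pow, hw, map_natCast, ← Complex.ofReal_pow, hs, Complex.ofReal_natCast]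
    rcases sq_eq_sq_iff_eq_or_eq_neg.1 h1 with h | h
    · exact ⟨_, hs, h⟩
    · exact ⟨-√l, by rw [neg_sq, hs], by rw [h, Complex.ofReal_neg]⟩
  have hε' : (A : ℝ) ^ 2 - l * B ^ 2 = -1 := by exact_mod_cast congrArg (Int.cast : ℤ → ℝ) hε
  have hB' : (0 : ℝ) < B := by exact_mod_cast hB
  refine Complex.star_eq_self_of_sq_eq_ofReal (r := n * (s * (A + B * s))) ?_ ?_
  · refine mul_nonneg (Nat.cast_nonneg n) ?_
    have h1 : (A * s) ^ 2 ≤ (B * l) ^ 2 := by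
      have : (0 : ℝ) ≤ l := Nat.cast_nonneg l
      rw [mul_pow, hs2]
      nlinarith
    have h2 := abs_le_of_sq_le_sq' h1 (mul_nonneg hB'.le (Nat.cast_nonneg l))
    nlinarith [h2.1]
  · rw [← map_pow, hD]
    simp only [map_mul, map_add, map_natCast, map_intCast, hsw]
    push_cast
    ring

theorem card_two_torsion_classGroup_of_adjoin_eq_top {K : Type*} [Field K] [NumberField K] {l : ℕ}
    (hl : l.Prime) (hl8 : l % 8 = 1) {w : K} (hw : w ^ 2 = l) {A B : ℤ} (hB : 0 < B)
    (hε : A ^ 2 - l * B ^ 2 = -1)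
    {P Q : Finset ℕ} (hPQ : Disjoint P Q) (hP : ∀ r ∈ P ∪ Q, r.Prime ∧ r % 4 = 3 ∧ r ≠ l)
    (hPl : ∀ r ∈ P, ¬ IsSquare (r : ZMod l)) (hQl : ∀ r ∈ Q, IsSquare (r : ZMod l))
    (hodd : Odd (P.card + Q.card)) {δ : ℕ} (hδ : δ = 1 ∨ δ = 2) {n : ℕ}
    (hn : n = δ * ∏ r ∈ P ∪ Q, r) {D : K} (hD : D ^ 2 = n * w * (A + B * w)) (hDK : ℚ⟮D⟯ = ⊤) :
    Nat.card {c : ClassGroup (𝓞 K) // c ^ 2 = 1} = 2 ^ (P.card + 2 * Q.card) := by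
  have hn0 : n ≠ 0 := by
    rw [hn]
    exact mul_ne_zero (by rcases hδ with rfl | rfl <;> norm_num)
      (Finset.prod_ne_zero_iff.2 fun r hr => (hP r hr).1.ne_zero)
  have := isTotallyReal_of_adjoin_eq_top hDK (star_eq_self_of_sq_eq hw hε hB hD)
  obtain ⟨hA4, hB4⟩ := four_dvd_and_mod_four_of_sq_sub_mul_sq hl8 hε hB
  let w' : ℚ⟮w⟯ := AdjoinSimple.gen ℚ w
  have hw' : w' ^ 2 = l := Subtype.ext (by simpa [w'] using hw)
  have hF : Algebra.IsQuadraticExtension ℚ ℚ⟮w⟯ :=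
    ⟨finrank_adjoin_simple_eq_two (a := l) (by rw [hw, map_natCast]) hl.rat_sq_ne⟩
  have hD' : D ^ 2 = algebraMap ℚ⟮w⟯ K (n * w' * (A + B * w')) := by
    rw [hD]
    simp [w']
  have hK : Algebra.IsQuadraticExtension ℚ⟮w⟯ K := by
    refine ⟨?_⟩
    have h1 := finrank_adjoin_simple_eq_two hD' (sq_ne_natCast_mul_of_norm_eq_neg_one hl hw' hε hn0)
    have h2 : ℚ⟮w⟯⟮D⟯ = ⊤ := by
      rw [eq_top_iff]
      intro x _
      have h3 : ℚ⟮D⟯ ≤ ℚ⟮w⟯⟮D⟯.restrictScalars ℚ :=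
        adjoin_simple_le_iff.2 (mem_adjoin_simple_self _ D)
      exact h3 (by rw [hDK]; trivial)
    rwa [h2, finrank_top'] at h1
  exact card_two_torsion_classGroup hl hl8 hw' hA4 hB4 hε hPQ hP hPl hQl hodd hδ hn hD'

end NumberField

theorem isSquare_iff_pow_eq_one {l : ℕ} (hl : l.Prime) (hl2 : l ≠ 2) {a : ZMod l} (ha : a ≠ 0) :
    IsSquare a ↔ a ^ ((l - 1) / 2) = 1 := by
  have : Fact l.Prime := ⟨hl⟩
  have h1 : (l - 1) / 2 = l / 2 := by
    have := hl.eq_two_or_odd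
    omega
  rw [h1, ZMod.euler_criterion l ha]

theorem isSquare_of_legSym_eq_one {l : ℕ} (hl : l.Prime) (hl2 : l ≠ 2) {a : ℕ}
    (h : legSym l a = 1) : IsSquare (a : ZMod l) := by
  unfold legSym at h
  rw [Int.cast_natCast] at h
  by_cases ha : (a : ZMod l) = 0
  · rw [ha]
    exact IsSquare.zero
  · rw [isSquare_iff_pow_eq_one hl hl2 ha]
    by_contra h1
    rw [if_neg h1, if_neg ha] at h
    norm_num at h

theorem not_isSquare_of_legSym_eq_neg_one {l : ℕ} (hl : l.Prime) (hl2 : l ≠ 2) {a : ℕ}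
    (h : legSym l a = -1) : ¬ IsSquare (a : ZMod l) := by
  unfold legSym at h
  rw [Int.cast_natCast] at h
  split_ifs at h with h1 ha
  rwa [isSquare_iff_pow_eq_one hl hl2 ha]

theorem IntermediateField.adjoin_adjoinSimple_gen (k : Type*) {L : Type*} [Field k] [Field L]
    [Algebra k L] (x : L) : adjoin k {AdjoinSimple.gen k x} = ⊤ := by
  apply lift_injective
  rw [lift_adjoin_simple, lift_top, AdjoinSimple.coe_gen]

/-- The square root of `l` lies in the field generated by a square root of `n√l(A + B√l)`. -/
theorem exists_sq_eq_of_adjoin {l n : ℕ} (hn : n ≠ 0) {A B : ℤ} (hA : A ≠ 0)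
    {K : IntermediateField ℚ ℝ} {D : K} (hD : (D : ℝ) ^ 2 = n * √(l : ℝ) * (A + B * √(l : ℝ))) :
    ∃ w : K, (w : ℝ) = √(l : ℝ) := by
  have hs : √(l : ℝ) ^ 2 = l := Real.sq_sqrt (Nat.cast_nonneg l)
  have hn' : (n : ℝ) ≠ 0 := by exact_mod_cast hn
  have hA' : (A : ℝ) ≠ 0 := by exact_mod_cast hA
  refine ⟨(D ^ 2 / n - B * l) / A, ?_⟩
  push_cast
  rw [hD]
  field_simp
  linear_combination (B : ℝ) * hs

/-- `l ≡ 1 (mod 8)` prime, `δ ∈ {1,2}`,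
`n = δ·p₁⋯p_{t₁}·q₁⋯q_{t₂}` with distinct primes `≡ 3 (mod 4)` coprime to `l`,
`(pᵢ/l) = -1`, `(qⱼ/l) = 1`, and `t₁ + t₂` odd.  Then `r₂(H) = t₁ + 2t₂`. -/
theorem stmt_4 (l : ℕ) (hl : l.Prime) (hl8 : l % 8 = 1)
    (ε₀ : ℝ) (hε : IsFundamentalUnit l ε₀)
    (hεnorm : ∃ u v : ℚ, ε₀ = (u : ℝ) + (v : ℝ) * Real.sqrt (l : ℝ) ∧
      (u : ℝ) ^ 2 - (v : ℝ) ^ 2 * (l : ℝ) = -1)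
    (δ : ℕ) (hδ : δ = 1 ∨ δ = 2)
    (t₁ t₂ : ℕ) (hodd : Odd (t₁ + t₂))
    (p : Fin t₁ → ℕ) (q : Fin t₂ → ℕ)
    (hpprime : ∀ i, (p i).Prime) (hqprime : ∀ j, (q j).Prime)
    (hpinj : Function.Injective p) (hqinj : Function.Injective q)
    (hpq : ∀ i j, p i ≠ q j)
    (hpl : ∀ i, p i ≠ l) (hql : ∀ j, q j ≠ l)
    (hp4 : ∀ i, p i % 4 = 3) (hq4 : ∀ j, q j % 4 = 3)
    (hpleg : ∀ i, legSym l (p i) = -1) (hqleg : ∀ j, legSym l (q j) = 1)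
    (n : ℕ) (hn : n = δ * ((∏ i, p i) * ∏ j, q j))
    (K : IntermediateField ℚ ℝ)
    (hK : K = IntermediateField.adjoin ℚ
      ({Real.sqrt ((n : ℝ) * ε₀ * Real.sqrt (l : ℝ))} : Set ℝ))
    [NumberField K] :
    twoTorsCard K = 2 ^ (t₁ + 2 * t₂) := by
  obtain ⟨hε1, -, hint, hinv, -⟩ := hε
  obtain ⟨u, v, rfl, hnorm⟩ := hεnorm
  have hs : √(l : ℝ) ^ 2 = l := Real.sq_sqrt (Nat.cast_nonneg l)
  have hs0 : 0 < √(l : ℝ) := Real.sqrt_pos.2 (by exact_mod_cast hl.pos)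
  obtain ⟨A, B, rfl, rfl⟩ := exists_int_of_isIntegral_of_norm_eq_neg_one hl hl8 hint hinv
    (by exact_mod_cast hnorm)
  simp only [Rat.cast_intCast] at *
  have hAB : A ^ 2 - l * B ^ 2 = -1 := by
    rw [mul_comm]
    exact_mod_cast hnorm
  have hB : 0 < B := by
    have h1 : (A + B * √(l : ℝ)) * (B * √(l : ℝ) - A) = 1 := by
      linear_combination (B : ℝ) ^ 2 * hs - hnorm
    have h2 : 0 < B * √(l : ℝ) - A := by
      by_contra! h
      nlinarith
    have h3 : 0 < B * √(l : ℝ) := by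
      by_contra! h
      nlinarith
    exact_mod_cast pos_of_mul_pos_left h3 hs0.le
  have hA : A ≠ 0 := by
    obtain ⟨hA4, hB4⟩ := four_dvd_and_mod_four_of_sq_sub_mul_sq hl8 hAB hB
    rintro rfl
    have h1 : (l : ℤ) * B ^ 2 = 1 := by linear_combination -hAB
    have h2 := Int.eq_one_of_mul_eq_one_right (Int.natCast_nonneg l) h1
    exact hl.ne_one (by exact_mod_cast h2)
  have hl2 : l ≠ 2 := by
    rintro rfl
    norm_num at hl8
  let P : Finset ℕ := Finset.univ.image p
  let Q : Finset ℕ := Finset.univ.image q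
  have hPQ : Disjoint P Q := by
    rw [Finset.disjoint_left]
    intro r hr hr'
    obtain ⟨i, -, rfl⟩ := Finset.mem_image.1 hr
    obtain ⟨j, -, hj⟩ := Finset.mem_image.1 hr'
    exact hpq i j hj.symm
  have hPcard : P.card = t₁ := by
    rw [Finset.card_image_of_injective _ hpinj, Finset.card_univ, Fintype.card_fin]
  have hQcard : Q.card = t₂ := by
    rw [Finset.card_image_of_injective _ hqinj, Finset.card_univ, Fintype.card_fin]
  have hprod : n = δ * ∏ r ∈ P ∪ Q, r := by
    rw [hn, Finset.prod_union hPQ, Finset.prod_image hpinj.injOn, Finset.prod_image hqinj.injOn]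
  have hP : ∀ r ∈ P ∪ Q, r.Prime ∧ r % 4 = 3 ∧ r ≠ l := by
    intro r hr
    rcases Finset.mem_union.1 hr with hr | hr <;> obtain ⟨i, -, rfl⟩ := Finset.mem_image.1 hr
    exacts [⟨hpprime i, hp4 i, hpl i⟩, ⟨hqprime i, hq4 i, hql i⟩]
  have hn0 : n ≠ 0 := by
    rw [hprod]
    exact mul_ne_zero (by rcases hδ with rfl | rfl <;> norm_num)
      (Finset.prod_ne_zero_iff.2 fun r hr => (hP r hr).1.ne_zero)
  have hDsq : √((n : ℝ) * (A + B * √(l : ℝ)) * √(l : ℝ)) ^ 2 =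
      n * √(l : ℝ) * (A + B * √(l : ℝ)) := by
    rw [Real.sq_sqrt (by positivity)]
    ring
  subst hK
  let D : IntermediateField.adjoin ℚ {√((n : ℝ) * (A + B * √(l : ℝ)) * √(l : ℝ))} :=
    IntermediateField.AdjoinSimple.gen ℚ _
  obtain ⟨w, hw⟩ := exists_sq_eq_of_adjoin (D := D) hn0 hA hDsq
  have hcard := NumberField.card_two_torsion_classGroup_of_adjoin_eq_top hl hl8 (w := w) (D := D)
    (Subtype.ext (by push_cast; rw [hw, hs])) hB hAB hPQ hP
    (fun r hr => by
      obtain ⟨i, -, rfl⟩ := Finset.mem_image.1 hr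
      exact not_isSquare_of_legSym_eq_neg_one hl hl2 (hpleg i))
    (fun r hr => by
      obtain ⟨j, -, rfl⟩ := Finset.mem_image.1 hr
      exact isSquare_of_legSym_eq_one hl hl2 (hqleg j))
    (by rwa [hPcard, hQcard]) hδ hprod
    (Subtype.ext (by push_cast; rw [hw]; exact hDsq)) (by
      convert! IntermediateField.adjoin_adjoinSimple_gen ℚ _)
  rw [hPcard, hQcard] at hcard
  exact hcard
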